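/- Let A=(C,m) be a 3-dimensional toric idealistic cluster, let r ≥ 2 be an integer, and let Z^{(r)}(s) be the associated rational function. If Z^{(r)} has a pole (i.e. is not holomorphic on ℂ), then there exists a node Q_k with r | N_k and Σ_{i: 1 ≤ i ≤ r', N_k | N_i} χ_i > 0, where r' is the number of nodes. (Via A'Campo's formula this is the holomorphy conjecture for surfaces general with respect to a 3-dimensional toric idealistic cluster: if r divides the order of no eigenvalue of the local monodromy, then Z^{(r)}_{top,f} is holomorphic on ℂ.) -/

import Mathlib

open Finset

/-!
Common framework: 3-dimensional toric constellations and toric idealistic clusters.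
The edge labels `1, 2, 3` of the paper are encoded as `0, 1, 2 : Fin 3`.
-/

/-- A 3-dimensional toric constellation: a finite rooted tree on nodes `0, …, r−1`
(node `0` the root, every child having larger index than its parent), each node having
at most three children, the edges from a node to its children carrying pairwise
distinct labels in `Fin 3`.  `label j` is the label of the edge from `parent j` to `j`
(irrelevant for the root). -/
structure ToricConstellation (r : ℕ) where
  parent : Fin r → Fin r
  label : Fin r → Fin 3
  parent_lt : ∀ i : Fin r, 0 < (i : ℕ) → (parent i : ℕ) < (i : ℕ)
  parent_root : ∀ i : Fin r, (i : ℕ) = 0 → parent i = i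
  label_distinct : ∀ i j : Fin r, 0 < (i : ℕ) → 0 < (j : ℕ) → i ≠ j →
    parent i = parent j → label i ≠ label j

namespace ToricConstellation

variable {r : ℕ}

/-- The ordered triple of vectors of `ℤ³` attached to a node: the root carries the
standard basis, and the child along the edge labelled `a` of a node with cone
`(u₁,u₂,u₃)` carries the triple obtained by replacing `u_a` with `u₁+u₂+u₃`. -/
def cone (C : ToricConstellation r) (i : Fin r) : Fin 3 → (Fin 3 → ℤ) :=
  if h : 0 < (i : ℕ) then
    Function.update (cone C (C.parent i)) (C.label i) (∑ a, cone C (C.parent i) a)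
  else fun a => Pi.single a 1
termination_by (i : ℕ)
decreasing_by all_goals exact C.parent_lt i h

/-- `v(Q) = u₁ + u₂ + u₃`, the sum of the cone vectors of a node. -/
def v (C : ToricConstellation r) (i : Fin r) : Fin 3 → ℤ := ∑ a, cone C i a

/-- `Prox C j i` means `j → i`, i.e. `Q_j` is proximate to `Q_i`:
`j ≠ i` and `v(Q_i)` is an entry of `cone(Q_j)`. -/
def Prox (C : ToricConstellation r) (j i : Fin r) : Prop :=
  j ≠ i ∧ ∃ a : Fin 3, cone C j a = v C i

instance (C : ToricConstellation r) (j i : Fin r) : Decidable (C.Prox j i) := by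
  unfold Prox; infer_instance

/-- `inChain C i a b j = true` iff `j = Q_i(a, b^t)` for some `t ≥ 0`, i.e. `j` is
reached from `i` by one edge labelled `a` followed by `t` edges labelled `b`. -/
def inChain (C : ToricConstellation r) (i : Fin r) (a b : Fin 3) (j : Fin r) : Bool :=
  if h : 0 < (j : ℕ) then
    (decide (C.parent j = i) && decide (C.label j = a)) ||
      (decide (C.label j = b) && inChain C i a b (C.parent j))
  else false
termination_by (j : ℕ)
decreasing_by exact C.parent_lt j h

/-- `LinProx C j i` means `j ↠ i`, i.e. `Q_j` is linearly proximate to `Q_i`. -/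
def LinProx (C : ToricConstellation r) (j i : Fin r) : Prop :=
  ∃ a b : Fin 3, a ≠ b ∧ inChain C i a b j = true

instance (C : ToricConstellation r) (j i : Fin r) : Decidable (C.LinProx j i) := by
  unfold LinProx; infer_instance

/-- `j` is a child of `i`. -/
def IsChild (C : ToricConstellation r) (j i : Fin r) : Prop :=
  0 < (j : ℕ) ∧ C.parent j = i

instance (C : ToricConstellation r) (j i : Fin r) : Decidable (C.IsChild j i) := by
  unfold IsChild; infer_instance

/-- The set `S_i` of labels of the edges on the path from the root to `Q_i`. -/
def labelsUnder (C : ToricConstellation r) (i : Fin r) : Finset (Fin 3) :=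
  if h : 0 < (i : ℕ) then insert (C.label i) (labelsUnder C (C.parent i)) else ∅
termination_by (i : ℕ)
decreasing_by exact C.parent_lt i h

/-- `i` is a weak ancestor of `j` (`i = j` or `i` a strict ancestor of `j`). -/
def anc (C : ToricConstellation r) (i j : Fin r) : Bool :=
  decide (i = j) || (if h : 0 < (j : ℕ) then anc C i (C.parent j) else false)
termination_by (j : ℕ)
decreasing_by exact C.parent_lt j h

/-- The set of nodes weakly above `i` (`i` together with its descendants). -/
def weakAbove (C : ToricConstellation r) (i : Fin r) : Finset (Fin r) :=
  univ.filter (fun j => anc C i j = true)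

end ToricConstellation

/-- A 3-dimensional toric cluster: a toric constellation together with a positive
integer weight for each node. -/
structure ToricCluster (r : ℕ) extends ToricConstellation r where
  m : Fin r → ℤ
  m_pos : ∀ j, 0 < m j

namespace ToricCluster

open ToricConstellation

variable {r : ℕ}

/-- `M_{Q_i}(a,b) := Σ_{t ≥ 0, Q_i(a,b^t) ∈ C} m_{Q_i(a,b^t)}`. -/
def M (A : ToricCluster r) (i : Fin r) (a b : Fin 3) : ℤ :=
  ∑ j ∈ univ.filter (fun j => inChain A.toToricConstellation i a b j = true), A.m j

/-- The cluster is idealistic: the linear proximity inequalities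
`M_{Q_i}(a,b) + M_{Q_i}(b,a) ≤ m_{Q_i}` hold. -/
def Idealistic (A : ToricCluster r) : Prop :=
  ∀ i : Fin r, ∀ a b : Fin 3, a ≠ b → A.M i a b + A.M i b a ≤ A.m i

/-- The set of nodes `j` proximate to `i` (`j → i`). -/
def proxSet (A : ToricCluster r) (i : Fin r) : Finset (Fin r) :=
  univ.filter (fun j => Prox A.toToricConstellation j i)

/-- `B_i`: the set of nodes to which `i` is proximate. -/
def Bset (A : ToricCluster r) (i : Fin r) : Finset (Fin r) :=
  univ.filter (fun j => Prox A.toToricConstellation i j)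

/-- `A_i`: the children `k` of `i` for which there is no `l` with `i → l` and `k → l`. -/
def Aset (A : ToricCluster r) (i : Fin r) : Finset (Fin r) :=
  univ.filter (fun k => IsChild A.toToricConstellation k i ∧
    ¬ ∃ l, Prox A.toToricConstellation i l ∧ Prox A.toToricConstellation k l)

/-- The Euler characteristic `χ_i = χ(E_i°)`. -/
def chi (A : ToricCluster r) (i : Fin r) : ℤ :=
  3 + A.m i * (A.m i - 3)
    - ∑ j ∈ A.proxSet i, A.m j * (A.m j - 1)
    + ∑ j ∈ A.proxSet i,
        (A.m j - ∑ k ∈ (A.proxSet i).filter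
          (fun k => LinProx A.toToricConstellation k j), A.m k)
    + ∑ j ∈ A.Bset i,
        (A.m i - ∑ k ∈ (A.proxSet j).filter
          (fun k => LinProx A.toToricConstellation k i), A.m k)
    - ((A.Aset i).card : ℤ) - 2 * ((A.Bset i).card : ℤ)
    + (((A.Bset i).card.choose 2 : ℕ) : ℤ)

/-- `D_i = m_i² − Σ_{j→i} m_j²`. -/
def D (A : ToricCluster r) (i : Fin r) : ℤ :=
  A.m i ^ 2 - ∑ j ∈ A.proxSet i, A.m j ^ 2

/-- `r_{ab} = m_i − M_{Q_i}(a,b) − M_{Q_i}(b,a)`. -/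
def rab (A : ToricCluster r) (i : Fin r) (a b : Fin 3) : ℤ :=
  A.m i - A.M i a b - A.M i b a

/-- `R_i = r̂_{12} + r̂_{13} + r̂_{23}`, where `r̂_{ab} = r_{ab}` if the remaining third
label does not appear under `Q_i`, and `r̂_{ab} = 0` otherwise.  (Labels `1,2,3` are
encoded as `0,1,2 : Fin 3`.) -/
def R (A : ToricCluster r) (i : Fin r) : ℤ :=
  (if (2 : Fin 3) ∉ labelsUnder A.toToricConstellation i then A.rab i 0 1 else 0)
  + (if (1 : Fin 3) ∉ labelsUnder A.toToricConstellation i then A.rab i 0 2 else 0)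
  + (if (0 : Fin 3) ∉ labelsUnder A.toToricConstellation i then A.rab i 1 2 else 0)

/-- `T_i = 3 − #A_i − 2·#B_i + (#B_i choose 2)`. -/
def T (A : ToricCluster r) (i : Fin r) : ℤ :=
  3 - ((A.Aset i).card : ℤ) - 2 * ((A.Bset i).card : ℤ)
    + (((A.Bset i).card.choose 2 : ℕ) : ℤ)

/-- The nodes to which `i` is proximate, of smaller index: the sums in the recursive
definitions of the numerical data range over the nodes to which `i` is proximate,
which are ancestors of `i` and hence have smaller index (making the recursion
well-founded). -/
def anteSet (A : ToricCluster r) (i : Fin r) : Finset (Fin r) :=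
  univ.filter (fun j => (j : ℕ) < (i : ℕ) ∧ Prox A.toToricConstellation i j)

/-- The numerical datum `N_i := m_i + Σ_{j : i→j} N_j`. -/
def N (A : ToricCluster r) (i : Fin r) : ℤ :=
  A.m i + ∑ j ∈ (A.anteSet i).attach, N A j.1
termination_by (i : ℕ)
decreasing_by
  have hj := j.2
  simp only [anteSet, Finset.mem_filter] at hj
  exact hj.2.1

/-- The numerical datum `ν_i := 3 + Σ_{j : i→j} (ν_j − 1)`. -/
def nu (A : ToricCluster r) (i : Fin r) : ℤ :=
  3 + ∑ j ∈ (A.anteSet i).attach, (nu A j.1 - 1)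
termination_by (i : ℕ)
decreasing_by
  have hj := j.2
  simp only [anteSet, Finset.mem_filter] at hj
  exact hj.2.1

end ToricCluster

namespace ToricCluster

open ToricConstellation

variable {r : ℕ}

/-- `χ_{0,i}`. -/
def chi0 (A : ToricCluster r) (i : Fin r) : ℤ :=
  A.m i * (3 - A.m i) + ∑ j ∈ A.proxSet i, A.m j * (A.m j - 1)
    - ∑ j ∈ A.proxSet i,
        (A.m j - ∑ k ∈ (A.proxSet i).filter
          (fun k => LinProx A.toToricConstellation k j), A.m k)
    - ∑ j ∈ A.Bset i,
        (A.m i - ∑ k ∈ (A.proxSet j).filter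
          (fun k => LinProx A.toToricConstellation k i), A.m k)

/-- `χ_{0,i,j} = m_j − Σ_{k: k→i, k↠j} m_k`, for `j → i`. -/
def chi0pair (A : ToricCluster r) (i j : Fin r) : ℤ :=
  A.m j - ∑ k ∈ (A.proxSet i).filter (fun k => LinProx A.toToricConstellation k j), A.m k

/-- `A_{ij}`: the children `k` of `j` with `k → i`. -/
def Apair (A : ToricCluster r) (i j : Fin r) : Finset (Fin r) :=
  univ.filter (fun k => IsChild A.toToricConstellation k j ∧ Prox A.toToricConstellation k i)

/-- `B_{ij} = {k ≠ i : j → k}`. -/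
def Bpair (A : ToricCluster r) (i j : Fin r) : Finset (Fin r) :=
  univ.filter (fun k => k ≠ i ∧ Prox A.toToricConstellation j k)

/-- `C_{ij}`: children `k` of `j` with `k → i` such that there is `l ≠ i` with
`k → l` and `j → l`. -/
def Cpair (A : ToricCluster r) (i j : Fin r) : Finset (Fin r) :=
  univ.filter (fun k => IsChild A.toToricConstellation k j ∧ Prox A.toToricConstellation k i ∧
    ∃ l, l ≠ i ∧ Prox A.toToricConstellation k l ∧ Prox A.toToricConstellation j l)

/-- `χ_{i,j}`, for `j → i`. -/
def chipair (A : ToricCluster r) (i j : Fin r) : ℤ :=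
  2 - A.chi0pair i j - ((A.Apair i j).card : ℤ) - ((A.Bpair i j).card : ℤ)
    + ((A.Cpair i j).card : ℤ)

/-- `χ_{i,j,k} = 1 − #{l : l→i, l→j, l→k}`, for `i < j < k`, `k → i`, `k → j`. -/
def chitriple (A : ToricCluster r) (i j k : Fin r) : ℤ :=
  1 - ((univ.filter (fun l => Prox A.toToricConstellation l i ∧
        Prox A.toToricConstellation l j ∧ Prox A.toToricConstellation l k)).card : ℤ)

/-- The linear factor `N_i·s + ν_i`, as a rational function in `s`. -/
noncomputable def lin (A : ToricCluster r) (i : Fin r) : RatFunc ℚ :=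
  (A.N i : RatFunc ℚ) * RatFunc.X + (A.nu i : RatFunc ℚ)

/-- The local topological zeta function of the cluster, as a rational function over `ℚ`:
`Z(s) = Σ_i [χ_i/(N_i s+ν_i) + χ_{0,i}/((s+1)(N_i s+ν_i))]
  + Σ_{j→i} [χ_{i,j}/((N_i s+ν_i)(N_j s+ν_j)) + χ_{0,i,j}/((s+1)(N_i s+ν_i)(N_j s+ν_j))]
  + Σ_{i<j<k, k→i, k→j} χ_{i,j,k}/((N_i s+ν_i)(N_j s+ν_j)(N_k s+ν_k))`. -/
noncomputable def Zeta (A : ToricCluster r) : RatFunc ℚ :=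
  (∑ i : Fin r,
      ((A.chi i : RatFunc ℚ) / A.lin i
        + (A.chi0 i : RatFunc ℚ) / ((RatFunc.X + 1) * A.lin i)))
  + (∑ p ∈ (univ ×ˢ univ).filter
        (fun p : Fin r × Fin r => Prox A.toToricConstellation p.2 p.1),
      ((A.chipair p.1 p.2 : RatFunc ℚ) / (A.lin p.1 * A.lin p.2)
        + (A.chi0pair p.1 p.2 : RatFunc ℚ) / ((RatFunc.X + 1) * (A.lin p.1 * A.lin p.2))))
  + (∑ t ∈ (univ : Finset (Fin r × Fin r × Fin r)).filter
        (fun t => t.1 < t.2.1 ∧ t.2.1 < t.2.2 ∧ Prox A.toToricConstellation t.2.2 t.1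
          ∧ Prox A.toToricConstellation t.2.2 t.2.1),
      (A.chitriple t.1 t.2.1 t.2.2 : RatFunc ℚ) / (A.lin t.1 * A.lin t.2.1 * A.lin t.2.2))

/-- The rational function `Z^{(r)}(s)` (here the positive integer is called `d`):
the same sum as `Z(s)`, keeping only the terms not containing the factor `(s+1)` and in
which every occurring index `i` satisfies `d ∣ N_i`. -/
noncomputable def ZetaR (A : ToricCluster r) (d : ℕ) : RatFunc ℚ :=
  (∑ i ∈ univ.filter (fun i : Fin r => (d : ℤ) ∣ A.N i),
      (A.chi i : RatFunc ℚ) / A.lin i)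
  + (∑ p ∈ (univ ×ˢ univ).filter
        (fun p : Fin r × Fin r => Prox A.toToricConstellation p.2 p.1
          ∧ (d : ℤ) ∣ A.N p.1 ∧ (d : ℤ) ∣ A.N p.2),
      (A.chipair p.1 p.2 : RatFunc ℚ) / (A.lin p.1 * A.lin p.2))
  + (∑ t ∈ (univ : Finset (Fin r × Fin r × Fin r)).filter
        (fun t => t.1 < t.2.1 ∧ t.2.1 < t.2.2 ∧ Prox A.toToricConstellation t.2.2 t.1
          ∧ Prox A.toToricConstellation t.2.2 t.2.1
          ∧ (d : ℤ) ∣ A.N t.1 ∧ (d : ℤ) ∣ A.N t.2.1 ∧ (d : ℤ) ∣ A.N t.2.2),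
      (A.chitriple t.1 t.2.1 t.2.2 : RatFunc ℚ) / (A.lin t.1 * A.lin t.2.1 * A.lin t.2.2))

end ToricCluster


open ToricConstellation ToricCluster

namespace ToricConstellation

variable {r : ℕ} (C : ToricConstellation r)

/-- `t` is the child of `i` along the edge labelled `x`. -/
def IsChildAt (i : Fin r) (x : Fin 3) (t : Fin r) : Prop :=
  0 < (t : ℕ) ∧ C.parent t = i ∧ C.label t = x

variable {C}

theorem IsChildAt.lt {i t : Fin r} {x : Fin 3} (h : C.IsChildAt i x t) : i < t := by
  have := C.parent_lt t h.1
  rw [h.2.1] at this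
  exact this

theorem IsChildAt.unique {i t u : Fin r} {x : Fin 3} (ht : C.IsChildAt i x t)
    (hu : C.IsChildAt i x u) : t = u := by
  by_contra hne
  exact C.label_distinct t u ht.1 hu.1 hne (ht.2.1.trans hu.2.1.symm)
    (ht.2.2.trans hu.2.2.symm)

variable (C)

/-! ### Distinct nodes have distinct vectors -/

/-- The labels on the path from the root to a node. -/
def path (i : Fin r) : List (Fin 3) :=
  if h : 0 < (i : ℕ) then path (C.parent i) ++ [C.label i] else []
termination_by (i : ℕ)
decreasing_by exact C.parent_lt i h

/-- Coordinates with respect to a cone, from those with respect to its child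
along the edge labelled `a`. -/
def stepCoord (a : Fin 3) (x : Fin 3 → ℤ) : Fin 3 → ℤ :=
  fun b => if b = a then x a else x b + x a

/-- Coordinates in the standard basis, from those with respect to the cone of the node with
the given path. -/
def pathCoord : List (Fin 3) → (Fin 3 → ℤ) → Fin 3 → ℤ
  | [], x => x
  | a :: l, x => stepCoord a (pathCoord l x)

theorem pathCoord_append (l : List (Fin 3)) (a : Fin 3) (x : Fin 3 → ℤ) :
    pathCoord (l ++ [a]) x = pathCoord l (stepCoord a x) := by
  induction l with
  | nil => rfl
  | cons b l ih => simp [pathCoord, ih]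

theorem pathCoord_pos (l : List (Fin 3)) (x : Fin 3 → ℤ) (hx : ∀ a, 0 < x a) (a : Fin 3) :
    0 < pathCoord l x a := by
  induction l generalizing a with
  | nil => exact hx a
  | cons b l ih =>
    simp only [pathCoord, stepCoord]
    split_ifs
    · exact ih b
    · exact add_pos (ih a) (ih b)

theorem stepCoord_ne_const {x : Fin 3 → ℤ} (hx : ∀ a, 0 < x a) (a : Fin 3) :
    stepCoord a x ≠ fun _ => 1 := by
  intro h
  obtain ⟨b, hb⟩ := exists_ne a
  have h1 := congrFun h b
  have h2 := hx b
  have h3 := hx a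
  simp only [stepCoord, if_neg hb] at h1
  omega

theorem stepCoord_label_eq {x y : Fin 3 → ℤ} (hx : ∀ a, 0 < x a) (hy : ∀ a, 0 < y a)
    {a b : Fin 3} (h : stepCoord a x = stepCoord b y) : a = b := by
  by_contra hab
  have h1 := congrFun h a
  have h2 := congrFun h b
  simp only [stepCoord, if_neg hab, if_neg (Ne.symm hab), if_true] at h1 h2
  have := hx b
  have := hy a
  omega

theorem stepCoord_injective (a : Fin 3) : Function.Injective (stepCoord a) := by
  intro x y h
  have ha := congrFun h a
  simp only [stepCoord, if_true] at ha
  funext b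
  have hb := congrFun h b
  by_cases hba : b = a
  · rw [hba, ha]
  · simpa [stepCoord, hba, ha] using hb

theorem pathCoord_one_injective {l l' : List (Fin 3)}
    (h : pathCoord l (fun _ => 1) = pathCoord l' fun _ => 1) : l = l' := by
  have hpos := fun l : List (Fin 3) => pathCoord_pos l (fun _ => 1) fun _ => one_pos
  induction l generalizing l' with
  | nil =>
    cases l' with
    | nil => rfl
    | cons b l' => exact absurd h.symm (stepCoord_ne_const (hpos l') b)
  | cons a l ih =>
    cases l' with
    | nil => exact absurd h (stepCoord_ne_const (hpos l) a)
    | cons b l' =>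
      obtain rfl := stepCoord_label_eq (hpos l) (hpos l') h
      rw [ih (stepCoord_injective a h)]

theorem sum_smul_cone (i : Fin r) (x : Fin 3 → ℤ) :
    ∑ a, x a • C.cone i a = pathCoord (C.path i) x := by
  induction i using WellFoundedLT.induction generalizing x with
  | ind i ih =>
    rw [cone, path]
    split_ifs with h
    · rw [pathCoord_append, ← ih _ (C.parent_lt i h)]
      generalize C.label i = a
      generalize C.cone (C.parent i) = w
      funext b
      fin_cases a <;> simp [Fin.sum_univ_three, stepCoord, Function.update_apply] <;> ring
    · funext b
      fin_cases b <;> simp [Fin.sum_univ_three, pathCoord]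

theorem v_eq_pathCoord (i : Fin r) : C.v i = pathCoord (C.path i) fun _ => 1 := by
  simp [← sum_smul_cone, v]

theorem path_injective : Function.Injective C.path := by
  intro i
  induction i using WellFoundedLT.induction with
  | ind i ih =>
    intro j h
    rw [path.eq_1 C i, path.eq_1 C j] at h
    split_ifs at h with hi hj hj
    · obtain ⟨h1, h2⟩ := List.append_inj' h rfl
      have h3 := ih _ (C.parent_lt i hi) h1
      exact IsChildAt.unique (C := C) ⟨hi, rfl, rfl⟩ ⟨hj, h3.symm, by simpa using h2.symm⟩
    · simp at h
    · simp at h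
    · exact Fin.ext (by omega)

theorem v_injective : Function.Injective C.v := fun i j h =>
  C.path_injective (pathCoord_one_injective (by rw [← v_eq_pathCoord, ← v_eq_pathCoord, h]))

theorem v_ne_single (i : Fin r) (a : Fin 3) : C.v i ≠ Pi.single a 1 := by
  intro h
  obtain ⟨b, hb⟩ := exists_ne a
  have := pathCoord_pos (C.path i) (fun _ => 1) (fun _ => one_pos) b
  rw [← v_eq_pathCoord, h, Pi.single_eq_of_ne hb] at this
  exact lt_irrefl _ this

/-! ### Cone entries and proximity -/

/-- The node whose vector is the entry `a` of the cone of `j`, if any. -/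
def entry (j : Fin r) (a : Fin 3) : Option (Fin r) :=
  if h : 0 < (j : ℕ) then
    if a = C.label j then some (C.parent j) else entry (C.parent j) a
  else none
termination_by (j : ℕ)
decreasing_by exact C.parent_lt j h

variable {C}

theorem IsChildAt.entry_self {i t : Fin r} {x : Fin 3} (h : C.IsChildAt i x t) :
    C.entry t x = some i := by
  rw [entry, dif_pos h.1, if_pos h.2.2.symm, h.2.1]

theorem IsChildAt.entry_of_ne {i t : Fin r} {x y : Fin 3} (h : C.IsChildAt i x t)
    (hy : y ≠ x) : C.entry t y = C.entry i y := by
  rw [entry, dif_pos h.1, if_neg (by rwa [h.2.2]), h.2.1]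

theorem lt_of_entry {j i : Fin r} {a : Fin 3} (h : C.entry j a = some i) : i < j := by
  induction j using WellFoundedLT.induction with
  | ind j ih =>
    rw [entry] at h
    split_ifs at h with h0 h1
    · rw [← Option.some.inj h]
      exact C.parent_lt j h0
    · exact (ih _ (C.parent_lt j h0) h).trans (C.parent_lt j h0)

theorem entry_label_unique {j i : Fin r} {a b : Fin 3} (ha : C.entry j a = some i)
    (hb : C.entry j b = some i) : a = b := by
  induction j using WellFoundedLT.induction with
  | ind j ih =>
    rw [entry] at ha hb
    split_ifs at ha hb with h0 h1 h2 h2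
    · exact h1.trans h2.symm
    · rw [← Option.some.inj ha] at hb
      exact absurd (lt_of_entry hb) (lt_irrefl _)
    · rw [← Option.some.inj hb] at ha
      exact absurd (lt_of_entry ha) (lt_irrefl _)
    · exact ih _ (C.parent_lt j h0) ha hb

variable (C)

theorem cone_eq_entry (j : Fin r) (a : Fin 3) :
    C.cone j a = (C.entry j a).elim (Pi.single a 1) C.v := by
  induction j using WellFoundedLT.induction with
  | ind j ih =>
    rw [cone, entry]
    split_ifs with h0 h1
    · rw [h1, Function.update_self]
      rfl
    · rw [Function.update_of_ne h1, ih _ (C.parent_lt j h0)]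
    · rfl

theorem prox_iff {j i : Fin r} : C.Prox j i ↔ ∃ a, C.entry j a = some i := by
  constructor
  · rintro ⟨-, a, ha⟩
    rw [cone_eq_entry] at ha
    cases h : C.entry j a with
    | none =>
      rw [h] at ha
      exact absurd ha.symm (C.v_ne_single i a)
    | some l =>
      rw [h] at ha
      exact ⟨a, h.trans (congrArg some (C.v_injective ha))⟩
  · rintro ⟨a, ha⟩
    refine ⟨(lt_of_entry ha).ne', a, ?_⟩
    rw [cone_eq_entry, ha]
    rfl

/-! ### Descending from a node along restricted labels -/

/-- `Reach C i x p j`: the node `j` is reached from `i` by one edge labelled `x` followed by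
edges with labels satisfying `p`. -/
inductive Reach (i : Fin r) (x : Fin 3) (p : Fin 3 → Prop) : Fin r → Prop
  | base {t : Fin r} (h : C.IsChildAt i x t) : Reach i x p t
  | step {t u : Fin r} {y : Fin 3} (h : Reach i x p t) (hu : C.IsChildAt t y u) (hy : p y) :
      Reach i x p u

variable {C}

theorem Reach.lt {i j : Fin r} {x : Fin 3} {p : Fin 3 → Prop} (h : C.Reach i x p j) :
    i < j := by
  induction h with
  | base h => exact h.lt
  | step _ hu _ ih => exact ih.trans hu.lt

theorem reach_iff {i j : Fin r} {x : Fin 3} {p : Fin 3 → Prop} :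
    C.Reach i x p j ↔ 0 < (j : ℕ) ∧
      ((C.parent j = i ∧ C.label j = x) ∨ (p (C.label j) ∧ C.Reach i x p (C.parent j))) := by
  constructor
  · rintro (h | ⟨h, hu, hy⟩)
    · exact ⟨h.1, Or.inl h.2⟩
    · refine ⟨hu.1, Or.inr ⟨?_, ?_⟩⟩
      · rwa [hu.2.2]
      · rwa [hu.2.1]
  · rintro ⟨h0, h | ⟨hp, h⟩⟩
    · exact .base ⟨h0, h⟩
    · exact .step h ⟨h0, rfl, rfl⟩ hp

theorem inChain_iff {i j : Fin r} {a b : Fin 3} :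
    C.inChain i a b j = true ↔ C.Reach i a (· = b) j := by
  induction j using WellFoundedLT.induction with
  | ind j ih =>
    rw [inChain, reach_iff]
    split_ifs with h0
    · simp [h0, ih _ (C.parent_lt j h0)]
    · simp [h0]

theorem entry_eq_some_iff {i j : Fin r} {a : Fin 3} :
    C.entry j a = some i ↔ C.Reach i a (· ≠ a) j := by
  induction j using WellFoundedLT.induction with
  | ind j ih =>
    rw [entry, reach_iff]
    split_ifs with h0 h1
    · constructor
      · intro h
        exact ⟨h0, Or.inl ⟨Option.some.inj h, h1.symm⟩⟩
      · rintro ⟨-, h | h⟩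
        · rw [h.1]
        · exact absurd h1.symm h.1
    · rw [ih _ (C.parent_lt j h0)]
      simp only [h0, true_and]
      constructor
      · exact fun h => Or.inr ⟨Ne.symm h1, h⟩
      · rintro (h | h)
        · exact absurd h.2.symm h1
        · exact h.2
    · simp [h0]

theorem reach_cons_iff {i j t : Fin r} {x : Fin 3} {p : Fin 3 → Prop}
    (ht : C.IsChildAt i x t) :
    C.Reach i x p j ↔ j = t ∨ ∃ y, p y ∧ C.Reach t y p j := by
  constructor
  · intro h
    induction h with
    | base h => exact Or.inl (h.unique ht)
    | step _ hu hy ih =>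
      right
      rcases ih with rfl | ⟨z, hz, h⟩
      · exact ⟨_, hy, .base hu⟩
      · exact ⟨z, hz, .step h hu hy⟩
  · rintro (rfl | ⟨y, hy, h⟩)
    · exact .base ht
    · induction h with
      | base h => exact .step (.base ht) h hy
      | step _ hu hy ih => exact .step ih hu hy

theorem Reach.label_unique {i j : Fin r} {x y : Fin 3} {p q : Fin 3 → Prop}
    (hx : C.Reach i x p j) (hy : C.Reach i y q j) : x = y := by
  induction hx with
  | base h =>
    rcases (reach_iff.1 hy).2 with h' | h'
    · exact h.2.2.symm.trans h'.2
    · rw [h.2.1] at h'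
      exact absurd h'.2.lt (lt_irrefl _)
  | step h hu _ ih =>
    rcases (reach_iff.1 hy).2 with h' | h'
    · rw [hu.2.1] at h'
      rw [h'.1] at h
      exact absurd h.lt (lt_irrefl _)
    · rw [hu.2.1] at h'
      exact ih h'.2

theorem Reach.mono {i j : Fin r} {x : Fin 3} {p q : Fin 3 → Prop} (h : C.Reach i x p j)
    (hpq : ∀ y, p y → q y) : C.Reach i x q j := by
  induction h with
  | base h => exact .base h
  | step _ hu hy ih => exact .step ih hu (hpq _ hy)

theorem Reach.entry_eq {i j : Fin r} {x c : Fin 3} {p : Fin 3 → Prop} (h : C.Reach i x p j)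
    (hx : c ≠ x) (hp : ∀ y, p y → c ≠ y) : C.entry j c = C.entry i c := by
  induction h with
  | base h => exact h.entry_of_ne hx
  | step _ hu hy ih => rw [hu.entry_of_ne (hp _ hy), ih]

theorem Reach.of_entry {i j l : Fin r} {x c : Fin 3} {p : Fin 3 → Prop} (h : C.Reach i x p j)
    (hj : C.entry j c = some l) (hl : l < i) :
    C.entry i c = some l ∧ c ≠ x ∧ C.Reach i x (fun y => p y ∧ c ≠ y) j := by
  induction h with
  | base h =>
    have hx : c ≠ x := by
      rintro rfl
      rw [h.entry_self] at hj
      exact hl.ne (Option.some.inj hj).symm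
    exact ⟨by rwa [← h.entry_of_ne hx], hx, .base h⟩
  | @step t u y h hu hy ih =>
    have hcy : c ≠ y := by
      rintro rfl
      rw [hu.entry_self] at hj
      exact (hl.trans h.lt).ne (Option.some.inj hj).symm
    rw [hu.entry_of_ne hcy] at hj
    obtain ⟨h1, h2, h3⟩ := ih hj
    exact ⟨h1, h2, .step h3 hu ⟨hy, hcy⟩⟩

theorem univ_fin_three {a b c : Fin 3} (hab : a ≠ b) (hac : a ≠ c) (hbc : b ≠ c) :
    (Finset.univ : Finset (Fin 3)) = {a, b, c} := by
  revert a b c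
  decide

theorem eq_of_ne_of_ne {a b c y : Fin 3} (hab : a ≠ b) (hac : a ≠ c) (hbc : b ≠ c)
    (ha : y ≠ a) (hc : y ≠ c) : y = b := by
  have h := Finset.mem_univ y
  rw [univ_fin_three hab hac hbc] at h
  simpa [ha, hc] using h

theorem Reach.exists_child {i j : Fin r} {x : Fin 3} {p : Fin 3 → Prop}
    (h : C.Reach i x p j) : ∃ t, C.IsChildAt i x t := by
  induction h with
  | base h => exact ⟨_, h⟩
  | step _ _ _ ih => exact ih

variable (C)

open Classical in
/-- The sum of `f` over the nodes reached from `i` by one edge labelled `x` followed by edges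
with labels satisfying `p`. -/
noncomputable def reachSum (f : Fin r → ℤ) (i : Fin r) (x : Fin 3) (p : Fin 3 → Prop) : ℤ :=
  ∑ j with C.Reach i x p j, f j

variable {C}

theorem reachSum_of_no_child {f : Fin r → ℤ} {i : Fin r} {x : Fin 3} {p : Fin 3 → Prop}
    (h : ¬ ∃ t, C.IsChildAt i x t) : C.reachSum f i x p = 0 := by
  classical
  rw [reachSum, Finset.filter_false_of_mem fun j _ hj => h hj.exists_child, Finset.sum_empty]

theorem reachSum_of_child {f : Fin r → ℤ} {i t : Fin r} {x : Fin 3} {p : Fin 3 → Prop}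
    [DecidablePred p] (h : C.IsChildAt i x t) :
    C.reachSum f i x p = f t + ∑ y with p y, C.reachSum f t y p := by
  classical
  have hset : Finset.univ.filter (C.Reach i x p) =
      insert t ((Finset.univ.filter p).biUnion fun y => Finset.univ.filter (C.Reach t y p)) := by
    ext j
    simp [reach_cons_iff h]
  rw [reachSum, hset, Finset.sum_insert, Finset.sum_biUnion]
  · rfl
  · intro y _ z _ hyz
    refine Finset.disjoint_left.2 fun j hj hj' => hyz ?_
    exact (Finset.mem_filter.1 hj).2.label_unique (Finset.mem_filter.1 hj').2
  · simp only [Finset.mem_biUnion, Finset.mem_filter, not_exists, not_and]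
    exact fun y _ _ hy => lt_irrefl _ hy.lt

theorem sum_fin_three {R : Type*} [AddCommMonoid R] {a b c : Fin 3} (hab : a ≠ b)
    (hac : a ≠ c) (hbc : b ≠ c) (f : Fin 3 → R) : ∑ x, f x = f a + f b + f c := by
  rw [univ_fin_three hab hac hbc, Finset.sum_insert (by simp [hab, hac]),
    Finset.sum_insert (by simp [hbc]), Finset.sum_singleton, add_assoc]

theorem reachSum_eq_of_child {f : Fin r → ℤ} {i t : Fin r} {x b : Fin 3}
    (h : C.IsChildAt i x t) :
    C.reachSum f i x (· = b) = f t + C.reachSum f t b (· = b) := by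
  simp [reachSum_of_child h, Finset.sum_filter]

theorem reachSum_ne_of_child {f : Fin r → ℤ} {i t : Fin r} {x a b c : Fin 3} (hab : a ≠ b)
    (hac : a ≠ c) (hbc : b ≠ c) (h : C.IsChildAt i x t) :
    C.reachSum f i x (· ≠ c) =
      f t + C.reachSum f t a (· ≠ c) + C.reachSum f t b (· ≠ c) := by
  rw [reachSum_of_child h, Finset.sum_filter, sum_fin_three hab hac hbc]
  simp [hac, hbc, add_assoc]

end ToricConstellation

namespace ToricCluster

variable {r : ℕ} (A : ToricCluster r)

/-! ### The numerical data in terms of children and cone entries -/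

theorem M_eq_reachSum (i : Fin r) (a b : Fin 3) : A.M i a b = A.reachSum A.m i a (· = b) := by
  classical
  exact Finset.sum_congr (Finset.filter_congr fun j _ => inChain_iff) fun _ _ => rfl

variable {A} in
theorem M_of_child {i t : Fin r} {x : Fin 3} (h : A.IsChildAt i x t) (b : Fin 3) :
    A.M i x b = A.m t + A.M t b b := by
  rw [M_eq_reachSum, reachSum_eq_of_child h, M_eq_reachSum]

variable {A} in
theorem M_of_no_child {i : Fin r} {x : Fin 3} (h : ¬ ∃ t, A.IsChildAt i x t) (b : Fin 3) :
    A.M i x b = 0 := by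
  rw [M_eq_reachSum, reachSum_of_no_child h]

theorem M_nonneg (i : Fin r) (a b : Fin 3) : 0 ≤ A.M i a b :=
  Finset.sum_nonneg fun j _ => (A.m_pos j).le

variable {A} in
theorem M_pos_of_child {i : Fin r} {x : Fin 3} (h : ∃ t, A.IsChildAt i x t) (b : Fin 3) :
    0 < A.M i x b := by
  obtain ⟨t, h⟩ := h
  rw [M_of_child h]
  exact add_pos_of_pos_of_nonneg (A.m_pos t) (A.M_nonneg t b b)

variable {A} in
theorem no_child_of_M_nonpos {i : Fin r} {x b : Fin 3} (h : A.M i x b ≤ 0) :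
    ¬ ∃ t, A.IsChildAt i x t := fun h' => (M_pos_of_child h' b).not_ge h

theorem sum_proxSet (i : Fin r) (f : Fin r → ℤ) :
    ∑ j ∈ A.proxSet i, f j = ∑ a, A.reachSum f i a (· ≠ a) := by
  classical
  simp only [reachSum]
  rw [← Finset.sum_biUnion]
  · refine Finset.sum_congr ?_ fun _ _ => rfl
    ext j
    simp [proxSet, prox_iff, entry_eq_some_iff]
  · intro a _ b _ hab
    refine Finset.disjoint_left.2 fun j hj hj' => hab ?_
    exact (Finset.mem_filter.1 hj).2.label_unique (Finset.mem_filter.1 hj').2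

theorem sum_Bset {R : Type*} [AddCommMonoid R] (i : Fin r) (f : Fin r → R) :
    ∑ j ∈ A.Bset i, f j = ∑ a, (A.entry i a).elim 0 f := by
  have hset : A.Bset i = Finset.univ.biUnion fun a => (A.entry i a).toFinset := by
    ext j
    simp [Bset, prox_iff]
  rw [hset, Finset.sum_biUnion]
  · refine Finset.sum_congr rfl fun a _ => ?_
    cases A.entry i a <;> simp
  · intro a _ b _ hab
    refine Finset.disjoint_left.2 fun j hj hj' => hab ?_
    exact entry_label_unique (Option.mem_toFinset.1 hj) (Option.mem_toFinset.1 hj')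

open Classical in
theorem card_children (i : Fin r) (q : Fin 3 → Prop) :
    #{k | A.IsChild k i ∧ q (A.label k)} =
      ∑ x, if (∃ t, A.IsChildAt i x t) ∧ q x then 1 else 0 := by
  rw [Finset.card_eq_sum_card_fiberwise (f := A.label) (t := Finset.univ)
    fun _ _ => Finset.mem_coe.2 (Finset.mem_univ _)]
  refine Finset.sum_congr rfl fun x _ => ?_
  split_ifs with h
  · obtain ⟨⟨t, ht⟩, hx⟩ := h
    rw [Finset.card_eq_one]
    refine ⟨t, ?_⟩
    ext k
    simp only [Finset.mem_filter, Finset.mem_univ, true_and, Finset.mem_singleton]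
    constructor
    · rintro ⟨⟨h1, -⟩, h2⟩
      exact IsChildAt.unique (C := A.toToricConstellation) ⟨h1.1, h1.2, h2⟩ ht
    · rintro rfl
      exact ⟨⟨⟨ht.1, ht.2.1⟩, by rwa [ht.2.2]⟩, ht.2.2⟩
  · rw [Finset.card_eq_zero, Finset.filter_eq_empty_iff]
    rintro k hk rfl
    obtain ⟨h1, h2⟩ := (Finset.mem_filter.1 hk).2
    exact h ⟨⟨k, h1.1, h1.2, rfl⟩, h2⟩

/-- The contribution to `N` of the cone entry `a`. -/
def entryN (i : Fin r) (a : Fin 3) : ℤ := (A.entry i a).elim 0 A.N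

theorem N_eq (i : Fin r) : A.N i = A.m i + ∑ a, A.entryN i a := by
  have h : A.anteSet i = A.Bset i := by
    refine Finset.filter_congr fun j _ => and_iff_right_of_imp fun h => ?_
    obtain ⟨a, ha⟩ := A.prox_iff.1 h
    exact lt_of_entry ha
  rw [N, Finset.sum_attach _ A.N, h, sum_Bset]
  rfl

theorem N_pos (i : Fin r) : 0 < A.N i := by
  induction i using WellFoundedLT.induction with
  | ind i ih =>
    rw [N_eq]
    refine add_pos_of_pos_of_nonneg (A.m_pos i) (Finset.sum_nonneg fun a _ => ?_)
    rw [entryN]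
    cases h : A.entry i a with
    | none => exact le_rfl
    | some l => exact (ih l (lt_of_entry h)).le

variable {A}

theorem entryN_of_entry {i l : Fin r} {a : Fin 3} (h : A.entry i a = some l) :
    A.entryN i a = A.N l := by
  rw [entryN, h]
  rfl

theorem entryN_of_none {i : Fin r} {a : Fin 3} (h : A.entry i a = none) :
    A.entryN i a = 0 := by
  rw [entryN, h]
  rfl

theorem N_eq_of_ne {a b c : Fin 3} (hab : a ≠ b) (hac : a ≠ c) (hbc : b ≠ c) (i : Fin r) :
    A.N i = A.m i + A.entryN i a + A.entryN i b + A.entryN i c := by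
  rw [N_eq, sum_fin_three hab hac hbc]
  ring

theorem entryN_child_self {i t : Fin r} {x : Fin 3} (h : A.IsChildAt i x t) :
    A.entryN t x = A.N i := entryN_of_entry h.entry_self

theorem entryN_child_of_ne {i t : Fin r} {x y : Fin 3} (h : A.IsChildAt i x t) (hy : y ≠ x) :
    A.entryN t y = A.entryN i y := by
  rw [entryN, entryN, h.entry_of_ne hy]

theorem rab_comm (i : Fin r) (a b : Fin 3) : A.rab i a b = A.rab i b a := by
  simp only [rab]
  ring

theorem chi0pair_eq {a b c : Fin 3} (hab : a ≠ b) (hac : a ≠ c) (hbc : b ≠ c) {i j : Fin r}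
    (h : A.entry j c = some i) : A.chi0pair i j = A.rab j a b := by
  classical
  have hset : (A.proxSet i).filter (fun k => LinProx A.toToricConstellation k j) =
      Finset.univ.filter (fun k => A.inChain j a b k = true) ∪
        Finset.univ.filter (fun k => A.inChain j b a k = true) := by
    ext k
    simp only [proxSet, Finset.mem_filter, Finset.mem_univ, true_and, Finset.mem_union,
      LinProx, inChain_iff, prox_iff]
    constructor
    · rintro ⟨⟨d, hd⟩, x, y, hxy, hk⟩
      obtain ⟨h1, h2, h3⟩ := hk.of_entry hd (lt_of_entry h)
      obtain rfl := entry_label_unique h h1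
      rcases eq_or_ne x a with rfl | hxa
      · exact Or.inl (h3.mono fun z hz =>
          eq_of_ne_of_ne hab hac hbc (hz.1 ▸ hxy.symm) hz.2.symm)
      · obtain rfl := eq_of_ne_of_ne hab hac hbc hxa h2.symm
        exact Or.inr (h3.mono fun z hz =>
          eq_of_ne_of_ne hab.symm hbc hac (hz.1 ▸ hxy.symm) hz.2.symm)
    · rintro (hk | hk)
      · exact ⟨⟨c, by rw [hk.entry_eq hac.symm fun z hz => hz ▸ hbc.symm, h]⟩, a, b, hab, hk⟩
      · exact ⟨⟨c, by rw [hk.entry_eq hbc.symm fun z hz => hz ▸ hac.symm, h]⟩, b, a, hab.symm,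
          hk⟩
  rw [chi0pair, hset, Finset.sum_union]
  · simp only [rab, M]
    ring
  · refine Finset.disjoint_left.2 fun k hk hk' => hab ?_
    exact (inChain_iff.1 (Finset.mem_filter.1 hk).2).label_unique
      (inChain_iff.1 (Finset.mem_filter.1 hk').2)

theorem reachSum_add_rab {a b c : Fin 3} (hab : a ≠ b) (hac : a ≠ c) (hbc : b ≠ c) (i : Fin r)
    (x : Fin 3) :
    A.reachSum (fun j => A.m j + A.rab j a b) i x (· ≠ c) = A.M i x a + A.M i x b := by
  induction i using WellFoundedGT.induction generalizing x with
  | ind i ih =>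
    by_cases hx : ∃ t, A.IsChildAt i x t
    · obtain ⟨t, ht⟩ := hx
      rw [reachSum_ne_of_child hab hac hbc ht, ih t ht.lt, ih t ht.lt, M_of_child ht,
        M_of_child ht, rab]
      ring
    · rw [reachSum_of_no_child hx, M_of_no_child hx, M_of_no_child hx, add_zero]

variable (A)

/-- The sum of the squares of the weights of the nodes proximate to `i` that lie above the child
of `i` along the edge labelled `a`. -/
noncomputable def cornerArea (i : Fin r) (a : Fin 3) : ℤ :=
  A.reachSum (fun j => A.m j ^ 2) i a (· ≠ a)

theorem D_eq (i : Fin r) : A.D i = A.m i ^ 2 - ∑ a, A.cornerArea i a := by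
  rw [D, sum_proxSet]
  rfl

open Classical in
/-- Indicator of the cone entry `a` of `i` being a standard basis vector. -/
noncomputable def free (i : Fin r) (a : Fin 3) : ℤ := if A.entry i a = none then 1 else 0

open Classical in
/-- Indicator of `i` having no child along the edge labelled `a`. -/
noncomputable def uncut (i : Fin r) (a : Fin 3) : ℤ :=
  if ∃ t, A.IsChildAt i a t then 0 else 1

variable {A}

theorem free_of_entry {i l : Fin r} {a : Fin 3} (h : A.entry i a = some l) : A.free i a = 0 :=
  if_neg (by simp [h])

theorem free_of_none {i : Fin r} {a : Fin 3} (h : A.entry i a = none) : A.free i a = 1 :=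
  if_pos h

theorem uncut_of_child {i : Fin r} {a : Fin 3} (h : ∃ t, A.IsChildAt i a t) :
    A.uncut i a = 0 := if_pos h

theorem uncut_of_no_child {i : Fin r} {a : Fin 3} (h : ¬ ∃ t, A.IsChildAt i a t) :
    A.uncut i a = 1 := if_neg h

theorem sum_proxSet_rab {a b c : Fin 3} (hab : a ≠ b) (hac : a ≠ c) (hbc : b ≠ c) (i : Fin r) :
    ∑ j ∈ A.proxSet i, (A.m j + A.chi0pair i j) =
      3 * A.m i - A.rab i a b - A.rab i a c - A.rab i b c := by
  have key : ∀ {a b c : Fin 3}, a ≠ b → a ≠ c → b ≠ c →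
      A.reachSum (fun j => A.m j + A.chi0pair i j) i c (· ≠ c) = A.M i c a + A.M i c b := by
    intro a b c hab hac hbc
    rw [← reachSum_add_rab hab hac hbc]
    classical
    refine Finset.sum_congr rfl fun j hj => ?_
    simp only
    rw [chi0pair_eq hab hac hbc (entry_eq_some_iff.2 (Finset.mem_filter.1 hj).2)]
  rw [sum_proxSet, sum_fin_three hab hac hbc, key hab hac hbc, key hac hab hbc.symm,
    key hbc hab.symm hac.symm]
  simp only [rab]
  ring

theorem sum_Bset_rab {a b c : Fin 3} (hab : a ≠ b) (hac : a ≠ c) (hbc : b ≠ c) (i : Fin r) :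
    ∑ j ∈ A.Bset i, A.chi0pair j i =
      (1 - A.free i c) * A.rab i a b + (1 - A.free i b) * A.rab i a c
        + (1 - A.free i a) * A.rab i b c := by
  have key : ∀ {a b c : Fin 3}, a ≠ b → a ≠ c → b ≠ c →
      (A.entry i c).elim 0 (fun j => A.chi0pair j i) = (1 - A.free i c) * A.rab i a b := by
    intro a b c hab hac hbc
    cases h : A.entry i c with
    | none => simp [free_of_none h]
    | some l => simp [free_of_entry h, chi0pair_eq hab hac hbc h]
  rw [sum_Bset, sum_fin_three hab hac hbc, key hab hac hbc, key hac hab hbc.symm,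
    key hbc hab.symm hac.symm]
  ring

theorem card_Bset {a b c : Fin 3} (hab : a ≠ b) (hac : a ≠ c) (hbc : b ≠ c) (i : Fin r) :
    ((A.Bset i).card : ℤ) = 3 - A.free i a - A.free i b - A.free i c := by
  have key : ∀ a, (A.entry i a).elim 0 (fun _ => (1 : ℤ)) = 1 - A.free i a := by
    intro a
    cases h : A.entry i a with
    | none => simp [free_of_none h]
    | some l => simp [free_of_entry h]
  rw [Finset.card_eq_sum_ones, Nat.cast_sum]
  simp only [Nat.cast_one]
  rw [sum_Bset, sum_fin_three hab hac hbc, key, key, key]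
  ring

theorem card_Aset {a b c : Fin 3} (hab : a ≠ b) (hac : a ≠ c) (hbc : b ≠ c) (i : Fin r) :
    ((A.Aset i).card : ℤ) = (1 - A.uncut i a) * (A.free i b * A.free i c)
      + (1 - A.uncut i b) * (A.free i a * A.free i c)
      + (1 - A.uncut i c) * (A.free i a * A.free i b) := by
  classical
  have hset : A.Aset i = Finset.univ.filter (fun k =>
      A.IsChild k i ∧ ∀ y, y ≠ A.label k → A.entry i y = none) := by
    refine Finset.filter_congr fun k _ => and_congr_right fun hk => ?_
    have hk' : A.IsChildAt i (A.label k) k := ⟨hk.1, hk.2, rfl⟩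
    simp only [prox_iff]
    constructor
    · intro h y hy
      by_contra hne
      obtain ⟨l, hl⟩ := Option.ne_none_iff_exists'.1 hne
      exact h ⟨l, ⟨y, hl⟩, y, by rw [hk'.entry_of_ne hy, hl]⟩
    · rintro h ⟨l, ⟨y, hy⟩, z, hz⟩
      have hzk : z ≠ A.label k := by
        intro h'
        rw [h', hk'.entry_self] at hz
        exact (lt_of_entry hy).ne (Option.some.inj hz).symm
      rw [hk'.entry_of_ne hzk, h z hzk] at hz
      simp at hz
  have key : ∀ {a b c : Fin 3}, a ≠ b → a ≠ c → b ≠ c →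
      (if (∃ t, A.IsChildAt i a t) ∧ ∀ y, y ≠ a → A.entry i y = none then (1 : ℤ) else 0) =
        (1 - A.uncut i a) * (A.free i b * A.free i c) := by
    intro a b c hab hac hbc
    have hforall : (∀ y, y ≠ a → A.entry i y = none) ↔
        A.entry i b = none ∧ A.entry i c = none := by
      constructor
      · exact fun h => ⟨h b hab.symm, h c hac.symm⟩
      · rintro ⟨hb, hc⟩ y hy
        rcases eq_or_ne y c with rfl | hyc
        · exact hc
        · rwa [eq_of_ne_of_ne hab hac hbc hy hyc]
    simp only [hforall, uncut, free]
    split_ifs <;> simp_all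
  have hcard := congrArg (Nat.cast : ℕ → ℤ)
    (A.card_children i fun x => ∀ y, y ≠ x → A.entry i y = none)
  rw [Nat.cast_sum, sum_fin_three hab hac hbc] at hcard
  push_cast at hcard
  rw [key hab hac hbc, key hab.symm hbc hac, key hac.symm hbc.symm hab] at hcard
  rw [hset, ← hcard]
  congr!

theorem chi_eq {a b c : Fin 3} (hab : a ≠ b) (hac : a ≠ c) (hbc : b ≠ c) (i : Fin r) :
    A.chi i = A.D i
      - A.free i a * A.rab i b c - A.free i b * A.rab i a c - A.free i c * A.rab i a b
      + A.uncut i a * (A.free i b * A.free i c) + A.uncut i b * (A.free i a * A.free i c)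
      + A.uncut i c * (A.free i a * A.free i b) := by
  have hprox := sum_proxSet_rab (A := A) hab hac hbc i
  have hB := sum_Bset_rab (A := A) hab hac hbc i
  have hcard := card_Bset (A := A) hab hac hbc i
  have hchoose : (((A.Bset i).card.choose 2 : ℕ) : ℤ) =
      (1 - A.free i a) * (1 - A.free i b) + (1 - A.free i a) * (1 - A.free i c)
        + (1 - A.free i b) * (1 - A.free i c) := by
    have h01 : ∀ a, A.free i a = 0 ∨ A.free i a = 1 := fun a => by
      rw [free]
      split_ifs <;> simp
    rcases h01 a with ha | ha <;> rcases h01 b with hb | hb <;> rcases h01 c with hc | hc <;>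
      (rw [ha, hb, hc] at hcard ⊢
       norm_num at hcard
       norm_cast at hcard
       simp [hcard])
  have hsq : ∑ j ∈ A.proxSet i, A.m j * (A.m j - 1) =
      ∑ j ∈ A.proxSet i, A.m j ^ 2 - ∑ j ∈ A.proxSet i, A.m j := by
    rw [← Finset.sum_sub_distrib]
    exact Finset.sum_congr rfl fun j _ => by ring
  rw [Finset.sum_add_distrib] at hprox
  simp only [chi0pair] at hprox hB
  rw [chi, hsq, hchoose, card_Aset hab hac hbc, hcard, hB, D]
  linear_combination hprox

/-! ### Estimates for `D` and `χ` -/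

theorem Idealistic.rab_nonneg (hA : A.Idealistic) (i : Fin r) {a b : Fin 3} (hab : a ≠ b) :
    0 ≤ A.rab i a b := by
  have := hA i a b hab
  rw [rab]
  linarith

theorem Idealistic.reachSum_sq_le (hA : A.Idealistic) {a b c : Fin 3} (hab : a ≠ b) (hac : a ≠ c)
    (hbc : b ≠ c) (i : Fin r) (x : Fin 3) :
    A.reachSum (fun j => A.m j ^ 2) i x (· ≠ c) ≤ A.M i x a * A.M i x b := by
  induction i using WellFoundedGT.induction generalizing x with
  | ind i ih =>
    by_cases hx : ∃ t, A.IsChildAt i x t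
    · obtain ⟨t, ht⟩ := hx
      rw [reachSum_ne_of_child hab hac hbc ht, M_of_child ht, M_of_child ht]
      have h1 := ih t ht.lt a
      have h2 := ih t ht.lt b
      have h3 := hA t a b hab
      have h4 := A.M_nonneg t a a
      have h5 := A.M_nonneg t b b
      have h6 := A.M_nonneg t a b
      have h7 := A.M_nonneg t b a
      nlinarith [mul_nonneg h4 h5, mul_nonneg h4 h7, mul_nonneg h5 h6]
    · rw [reachSum_of_no_child hx, M_of_no_child hx, zero_mul]

theorem Idealistic.cornerArea_le (hA : A.Idealistic) {a b c : Fin 3} (hab : a ≠ b) (hac : a ≠ c)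
    (hbc : b ≠ c) (i : Fin r) : A.cornerArea i a ≤ A.M i a b * A.M i a c :=
  hA.reachSum_sq_le hbc hab.symm hac.symm i a

/-- When the two chains at a corner have the same weight `w`, either the corner consists of a
single chain starting with a node of weight `w`, or its area is at most `w ^ 2 - w`. -/
theorem Idealistic.cornerArea_gap (hA : A.Idealistic) {a b c : Fin 3} (hab : a ≠ b) (hac : a ≠ c)
    (hbc : b ≠ c) {i t : Fin r} (ht : A.IsChildAt i a t) (h : A.M i a b = A.M i a c) :
    (A.m t = A.M i a b ∧ (¬ ∃ u, A.IsChildAt t b u) ∧ ¬ ∃ u, A.IsChildAt t c u) ∨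
      A.cornerArea i a + A.M i a b ≤ A.M i a b ^ 2 := by
  rw [M_of_child ht, M_of_child ht] at h
  rw [cornerArea, reachSum_ne_of_child hbc hab.symm hac.symm ht, M_of_child ht]
  rcases (A.M_nonneg t b b).eq_or_lt with h0 | h0
  · exact Or.inl ⟨by rw [← h0, add_zero], no_child_of_M_nonpos h0.ge,
      no_child_of_M_nonpos (b := c) (by linarith)⟩
  · have h1 := hA.reachSum_sq_le hbc hab.symm hac.symm t b
    have h2 := hA.reachSum_sq_le hbc hab.symm hac.symm t c
    have h3 := hA t b c hbc
    have h4 := A.m_pos t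
    right
    rw [← add_left_cancel h] at h2
    nlinarith [mul_le_mul_of_nonneg_left h3 h0.le, mul_nonneg (show 0 ≤ A.M t b b - 1 by linarith)
      (show 0 ≤ A.m t + A.M t b b by linarith)]

theorem Idealistic.D_ge (hA : A.Idealistic) {a b c : Fin 3} (hab : a ≠ b) (hac : a ≠ c)
    (hbc : b ≠ c) (i : Fin r) :
    A.m i ^ 2 - A.M i a b * A.M i a c - A.M i b a * A.M i b c - A.M i c a * A.M i c b ≤
      A.D i := by
  have h1 := hA.cornerArea_le hab hac hbc i
  have h2 := hA.cornerArea_le hab.symm hbc hac i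
  have h3 := hA.cornerArea_le hac.symm hbc.symm hab i
  rw [D_eq, sum_fin_three hab hac hbc]
  linarith

theorem Idealistic.mul_rab_le_D (hA : A.Idealistic) {a b c : Fin 3} (hab : a ≠ b) (hac : a ≠ c)
    (hbc : b ≠ c) (i : Fin r) : (A.m i - A.M i a b) * A.rab i b c ≤ A.D i := by
  have h := hA.D_ge hab hac hbc i
  have h1 := hA i a b hab
  have h2 := hA i a c hac
  have h3 := hA.rab_nonneg i hbc
  have hr : A.rab i b c = A.m i - A.M i b c - A.M i c b := rfl
  have h4 := A.M_nonneg i a b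
  have h5 := A.M_nonneg i a c
  have h6 := A.M_nonneg i b a
  have h7 := A.M_nonneg i b c
  have h8 := A.M_nonneg i c a
  have h9 := A.M_nonneg i c b
  have h10 := mul_le_mul_of_nonneg_right (show A.M i b a ≤ A.m i - A.M i a b by linarith) h7
  have h11 := mul_le_mul_of_nonneg_right (show A.M i c a ≤ A.m i - A.M i a c by linarith) h9
  rcases le_total (A.m i - A.M i a b) (A.m i - A.M i a c) with h12 | h12
  · nlinarith [mul_nonneg (show 0 ≤ A.m i - A.M i a b by linarith) h5,
      mul_nonneg (sub_nonneg.2 h12) h7, mul_nonneg (sub_nonneg.2 h12) h3]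
  · nlinarith [mul_nonneg (show 0 ≤ A.m i - A.M i a c by linarith) h4,
      mul_nonneg (sub_nonneg.2 h12) h9, mul_nonneg (sub_nonneg.2 h12) h3]

theorem Idealistic.D_nonneg (hA : A.Idealistic) (i : Fin r) : 0 ≤ A.D i := by
  refine le_trans ?_ (hA.mul_rab_le_D (show (0 : Fin 3) ≠ 1 by decide)
    (show (0 : Fin 3) ≠ 2 by decide) (show (1 : Fin 3) ≠ 2 by decide) i)
  have h1 := hA i 0 1 (by decide)
  have h2 := A.M_nonneg i 1 0
  exact mul_nonneg (by linarith) (hA.rab_nonneg i (by decide))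

/-- If `D` is smaller than `r_{bc}`, then the only child of `i` lies along the remaining label `a`,
and it carries the weight of `i`. -/
theorem Idealistic.exists_child_of_D_lt (hA : A.Idealistic) {a b c : Fin 3} (hab : a ≠ b)
    (hac : a ≠ c) (hbc : b ≠ c) {i : Fin r} (h : A.D i < A.rab i b c) :
    ((¬ ∃ t, A.IsChildAt i b t) ∧ ¬ ∃ t, A.IsChildAt i c t) ∧
      ∃ t, A.IsChildAt i a t ∧ A.m t = A.m i ∧
        (¬ ∃ u, A.IsChildAt t b u) ∧ ¬ ∃ u, A.IsChildAt t c u := by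
  have hH := hA.mul_rab_le_D hab hac hbc i
  have hH' := hA.mul_rab_le_D hac hab hbc.symm i
  rw [rab_comm i c b] at hH'
  have h1 := hA i a b hab
  have h2 := hA i a c hac
  have h4 := A.M_nonneg i b a
  have h5 := A.M_nonneg i c a
  have hr := hA.rab_nonneg i hbc
  have hα : A.M i a b = A.m i := by nlinarith
  have hα' : A.M i a c = A.m i := by nlinarith
  have hb : ¬ ∃ t, A.IsChildAt i b t := no_child_of_M_nonpos (b := a) (by linarith)
  have hc : ¬ ∃ t, A.IsChildAt i c t := no_child_of_M_nonpos (b := a) (by linarith)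
  refine ⟨⟨hb, hc⟩, ?_⟩
  obtain ⟨t, ht⟩ : ∃ t, A.IsChildAt i a t := by
    by_contra hno
    rw [M_of_no_child hno] at hα
    exact (A.m_pos i).ne hα
  refine ⟨t, ht, ?_⟩
  rcases hA.cornerArea_gap hab hac hbc ht (hα.trans hα'.symm) with hg | hg
  · rwa [hα] at hg
  · have hzero := hA.cornerArea_le hab.symm hbc hac i
    have hzero' := hA.cornerArea_le hac.symm hbc.symm hab i
    rw [D_eq, sum_fin_three hab hac hbc] at h
    rw [M_of_no_child hb] at hzero
    rw [M_of_no_child hc] at hzero'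
    have : A.rab i b c = A.m i := by
      rw [rab, M_of_no_child hb, M_of_no_child hc, sub_zero, sub_zero]
    rw [hα] at hg
    linarith

theorem Idealistic.exists_chi_pos (hA : A.Idealistic) {a b c : Fin 3} (hab : a ≠ b)
    (hac : a ≠ c) (hbc : b ≠ c) {k l : Fin r} (hl : A.entry k c = some l)
    (ha : ¬ ∃ t, A.IsChildAt k a t) (hb : ¬ ∃ t, A.IsChildAt k b t)
    (hm : 2 ≤ A.m k ∨ A.entry k a ≠ none ∧ A.entry k b ≠ none) :
    ∃ j, ∃ n : ℕ, 0 < A.chi j ∧ A.N j = A.N k + n * (A.N k - A.N l) := by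
  induction k using WellFoundedGT.induction generalizing l with
  | ind k ih =>
    rcases lt_or_ge 0 (A.D k) with hD | hD
    · refine ⟨k, 0, ?_, by simp⟩
      have hr : A.rab k b c = A.m k - A.M k c b := by
        rw [rab, M_of_no_child hb, sub_zero]
      have hr' : A.rab k a c = A.m k - A.M k c a := by
        rw [rab, M_of_no_child ha, sub_zero]
      have hra := hA.rab_nonneg k hbc
      have hrb := hA.rab_nonneg k hac
      have hHa := hA.mul_rab_le_D hab hac hbc k
      have hHb := hA.mul_rab_le_D hab.symm hbc hac k
      rw [M_of_no_child ha, sub_zero] at hHa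
      rw [M_of_no_child hb, sub_zero] at hHb
      rw [chi_eq hab hac hbc, free_of_entry hl, uncut_of_no_child ha, uncut_of_no_child hb]
      rw [hr, hr'] at *
      rcases h1 : A.entry k a with _ | l1 <;> rcases h2 : A.entry k b with _ | l2
      · rw [free_of_none h1, free_of_none h2]
        replace hm := hm.resolve_right fun h => h.1 h1
        have hDge := hA.D_ge hab hac hbc k
        rw [M_of_no_child ha, M_of_no_child hb] at hDge
        by_cases hc : ∃ t, A.IsChildAt k c t
        · have h3 := M_pos_of_child hc a
          have h4 := M_pos_of_child hc b
          rw [uncut_of_child hc]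
          by_cases h5 : A.M k c a = A.m k ∧ A.M k c b = A.m k
          · rw [h5.1, h5.2]
            linarith
          · have h6 : A.M k c a < A.m k ∨ A.M k c b < A.m k := by
              by_contra hcon
              push Not at hcon
              exact h5 ⟨by linarith, by linarith⟩
            rcases h6 with h6 | h6
            · nlinarith [mul_nonneg (show 0 ≤ A.m k - 1 - A.M k c a by linarith)
                (show 0 ≤ A.M k c b - 1 by linarith),
                mul_nonneg (show 0 ≤ A.m k - 2 by linarith) hra]
            · nlinarith [mul_nonneg (show 0 ≤ A.m k - 1 - A.M k c b by linarith)
                (show 0 ≤ A.M k c a - 1 by linarith),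
                mul_nonneg (show 0 ≤ A.m k - 2 by linarith) hrb]
        · rw [uncut_of_no_child hc]
          rw [M_of_no_child hc] at hDge ⊢
          rw [M_of_no_child hc]
          nlinarith
      · rw [free_of_none h1, free_of_entry h2]
        replace hm := hm.resolve_right fun h => h.1 h1
        nlinarith
      · rw [free_of_entry h1, free_of_none h2]
        replace hm := hm.resolve_right fun h => h.2 h2
        nlinarith
      · rw [free_of_entry h1, free_of_entry h2]
        linarith
    · have hlt : A.D k < A.rab k a b := by
        rw [rab, M_of_no_child ha, M_of_no_child hb]
        linarith [A.m_pos k]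
      obtain ⟨-, t, ht, hmt, hta, htb⟩ := hA.exists_child_of_D_lt hac.symm hbc.symm hab hlt
      rw [← hmt, ← ht.entry_of_ne hac, ← ht.entry_of_ne hbc] at hm
      obtain ⟨j, n, hj, hN⟩ := ih t ht.lt ht.entry_self hta htb hm
      refine ⟨j, n + 1, hj, ?_⟩
      have h1 := N_eq_of_ne (A := A) hab hac hbc t
      have h2 := N_eq_of_ne (A := A) hab hac hbc k
      rw [entryN_child_self ht, entryN_child_of_ne ht hac, entryN_child_of_ne ht hbc, hmt] at h1
      rw [entryN_of_entry hl] at h2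
      rw [hN]
      push_cast
      linear_combination (n + 1 : ℤ) * h1 - (n + 1 : ℤ) * h2

/-- The estimate behind `0 ≤ D`, for arbitrary integers around a hexagon. -/
theorem hexagon_le {h x x' y y' z z' : ℤ} (hx : 0 ≤ x) (hx' : 0 ≤ x') (hy' : 0 ≤ y')
    (hz' : 0 ≤ z') (hxy : x + y ≤ h) (hxz : x' + z ≤ h) (hyz : y' + z' ≤ h) (hxh : x ≤ h)
    (hxh' : x' ≤ h) : x * x' + y * y' + z * z' ≤ h ^ 2 := by
  have h1 := mul_le_mul_of_nonneg_right (show y ≤ h - x by linarith) hy'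
  have h2 := mul_le_mul_of_nonneg_right (show z ≤ h - x' by linarith) hz'
  rcases le_total x x' with h3 | h3
  · nlinarith [mul_nonneg (sub_nonneg.2 h3) hy', mul_nonneg (sub_nonneg.2 hxh') hx,
      mul_nonneg (sub_nonneg.2 hxh') hx', mul_nonneg (sub_nonneg.2 hxh) (sub_nonneg.2 hyz),
      mul_nonneg (sub_nonneg.2 hxh') (sub_nonneg.2 hyz)]
  · nlinarith [mul_nonneg (sub_nonneg.2 h3) hz', mul_nonneg (sub_nonneg.2 hxh') hx,
      mul_nonneg (sub_nonneg.2 hxh) hx', mul_nonneg (sub_nonneg.2 hxh) (sub_nonneg.2 hyz),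
      mul_nonneg (sub_nonneg.2 hxh') (sub_nonneg.2 hyz)]

theorem Idealistic.chi_nonneg_of_two_free (hA : A.Idealistic) {a b c : Fin 3} (hab : a ≠ b)
    (hac : a ≠ c) (hbc : b ≠ c) {i l : Fin r} (ha : A.entry i a = none)
    (hb : A.entry i b = none) (hc : A.entry i c = some l) (hDa : A.rab i b c ≤ A.D i)
    (hDb : A.rab i a c ≤ A.D i) : 0 ≤ A.chi i := by
  rw [chi_eq hab hac hbc, free_of_none ha, free_of_none hb, free_of_entry hc]
  have hra := hA.rab_nonneg i hbc
  have hrb := hA.rab_nonneg i hac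
  have hD := hA.D_ge hab hac hbc i
  have h1 := hA i a b hab
  have h2 := A.M_nonneg i a b
  have h3 := A.M_nonneg i b a
  have h4 := A.M_nonneg i a c
  have h5 := A.M_nonneg i b c
  have hγ := A.M_nonneg i c a
  have hγ' := A.M_nonneg i c b
  have hra' : A.rab i b c = A.m i - A.M i b c - A.M i c b := rfl
  have hrb' : A.rab i a c = A.m i - A.M i a c - A.M i c a := rfl
  have key : A.M i c a * A.rab i b c + A.M i c b * A.rab i a c + A.rab i b c * A.rab i a c ≤
      A.D i := by
    rcases le_total (A.M i a c) (A.M i b c) with h | h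
    · nlinarith [mul_le_mul_of_nonneg_left h h2, mul_le_mul_of_nonneg_right h1 h5,
        mul_nonneg hra h4]
    · nlinarith [mul_le_mul_of_nonneg_left h h3, mul_le_mul_of_nonneg_right h1 h4,
        mul_nonneg hrb h5]
  rcases hra.eq_or_lt with hra0 | hra0
  · rw [← hra0]
    by_cases hcc : ∃ t, A.IsChildAt i c t
    · rw [uncut_of_child hcc]
      linarith
    · rw [uncut_of_no_child hcc]
      linarith
  · by_cases hcc : ∃ t, A.IsChildAt i c t
    · have h6 := M_pos_of_child hcc a
      have h7 := M_pos_of_child hcc b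
      rw [uncut_of_child hcc]
      nlinarith
    · rw [uncut_of_no_child hcc]
      rw [M_of_no_child hcc, M_of_no_child hcc] at key
      rcases hrb.eq_or_lt with hrb0 | hrb0
      · linarith
      · nlinarith

/-- The lower bound for `χ` at a node with standard cone, with every corner cut off replaced by
its bounding rectangle. -/
theorem Idealistic.chi_ge_of_free (hA : A.Idealistic) {a b c : Fin 3} (hab : a ≠ b)
    (hac : a ≠ c) (hbc : b ≠ c) {i : Fin r} (ha : A.entry i a = none)
    (hb : A.entry i b = none) (hc : A.entry i c = none) :
    A.m i ^ 2 - 3 * A.m i + 3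
      - (1 - A.uncut i a) * ((A.M i a b - 1) * (A.M i a c - 1))
      - (1 - A.uncut i b) * ((A.M i b a - 1) * (A.M i b c - 1))
      - (1 - A.uncut i c) * ((A.M i c a - 1) * (A.M i c b - 1)) ≤ A.chi i := by
  have hcorner : ∀ x y z : Fin 3, (1 - A.uncut i x) * ((A.M i x y - 1) * (A.M i x z - 1)) =
      A.M i x y * A.M i x z - A.M i x y - A.M i x z + 1 - A.uncut i x := by
    intro x y z
    by_cases hx : ∃ t, A.IsChildAt i x t
    · rw [uncut_of_child hx]
      ring
    · rw [uncut_of_no_child hx, M_of_no_child hx, M_of_no_child hx]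
      ring
  have hD := hA.D_ge hab hac hbc i
  rw [chi_eq hab hac hbc, free_of_none ha, free_of_none hb, free_of_none hc, hcorner, hcorner,
    hcorner]
  simp only [rab]
  linarith

theorem Idealistic.chi_nonneg_of_free (hA : A.Idealistic) {i : Fin r}
    (hfree : ∀ x, A.entry i x = none)
    (hD : ∀ a b c : Fin 3, a ≠ b → a ≠ c → b ≠ c → 2 ≤ A.m i → A.rab i b c ≤ A.D i) :
    0 ≤ A.chi i := by
  have hge := fun {a b c : Fin 3} (hab : a ≠ b) (hac : a ≠ c) (hbc : b ≠ c) =>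
    hA.chi_ge_of_free hab hac hbc (hfree a) (hfree b) (hfree c)
  have hm := A.m_pos i
  have key2 : ∀ {a b c : Fin 3}, a ≠ b → a ≠ c → b ≠ c → (∃ t, A.IsChildAt i a t) →
      (∃ t, A.IsChildAt i b t) → (¬ ∃ t, A.IsChildAt i c t) → 0 ≤ A.chi i := by
    intro a b c hab hac hbc ha hb hc
    have h := hge hab hac hbc
    rw [uncut_of_child ha, uncut_of_child hb, uncut_of_no_child hc] at h
    have h1 := M_pos_of_child ha b
    have h2 := M_pos_of_child ha c
    have h3 := M_pos_of_child hb a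
    have h4 := M_pos_of_child hb c
    have h5 := hA i a b hab
    have h6 := hA i a c hac
    have h7 := hA i b c hbc
    have h8 := A.M_nonneg i c a
    have h9 := A.M_nonneg i c b
    nlinarith [mul_le_mul_of_nonneg_left (show A.M i a c - 1 ≤ A.m i - 1 by linarith)
      (show 0 ≤ A.M i a b - 1 by linarith),
      mul_le_mul_of_nonneg_left (show A.M i b c - 1 ≤ A.m i - 1 by linarith)
      (show 0 ≤ A.M i b a - 1 by linarith),
      mul_le_mul_of_nonneg_right h5 (show 0 ≤ A.m i - 1 by linarith)]
  have key1 : ∀ {a b c : Fin 3}, a ≠ b → a ≠ c → b ≠ c → (∃ t, A.IsChildAt i a t) →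
      (¬ ∃ t, A.IsChildAt i b t) → (¬ ∃ t, A.IsChildAt i c t) → 0 ≤ A.chi i := by
    intro a b c hab hac hbc ha hb hc
    have h := hge hab hac hbc
    rw [uncut_of_child ha, uncut_of_no_child hb, uncut_of_no_child hc] at h
    have h1 := M_pos_of_child ha b
    have h2 := M_pos_of_child ha c
    have h5 := hA i a b hab
    have h6 := hA i a c hac
    rw [M_of_no_child hb] at h5
    rw [M_of_no_child hc] at h6
    rcases (show A.M i a b ≤ A.m i by linarith).eq_or_lt with h7 | h7
    · rcases (show A.M i a c ≤ A.m i by linarith).eq_or_lt with h8 | h8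
      · rcases lt_or_ge (A.m i) 2 with hm2 | hm2
        · rw [h7, h8, show A.m i = 1 by linarith] at h
          linarith
        · have h9 := hD a b c hab hac hbc hm2
          rw [chi_eq hab hac hbc, free_of_none (hfree a), free_of_none (hfree b),
            free_of_none (hfree c), uncut_of_child ha, uncut_of_no_child hb,
            uncut_of_no_child hc]
          simp only [rab, M_of_no_child hb, M_of_no_child hc, h7, h8] at h9 ⊢
          linarith
      · nlinarith [mul_nonneg (show 0 ≤ A.m i - 1 - A.M i a c by linarith)
          (show 0 ≤ A.m i - 1 by linarith)]
    · nlinarith [mul_nonneg (show 0 ≤ A.m i - 1 - A.M i a b by linarith)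
        (show 0 ≤ A.M i a c - 1 by linarith), mul_nonneg (show 0 ≤ A.m i - A.M i a c by linarith)
        (show 0 ≤ A.m i - 2 by linarith)]
  have h01 : (0 : Fin 3) ≠ 1 := by decide
  have h02 : (0 : Fin 3) ≠ 2 := by decide
  have h12 : (1 : Fin 3) ≠ 2 := by decide
  by_cases h0 : ∃ t, A.IsChildAt i 0 t <;> by_cases h1 : ∃ t, A.IsChildAt i 1 t <;>
    by_cases h2 : ∃ t, A.IsChildAt i 2 t
  · have h := hge h01 h02 h12
    rw [uncut_of_child h0, uncut_of_child h1, uncut_of_child h2] at h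
    have p1 := M_pos_of_child h0 1
    have p2 := M_pos_of_child h0 2
    have p3 := M_pos_of_child h1 0
    have p4 := M_pos_of_child h1 2
    have p5 := M_pos_of_child h2 0
    have p6 := M_pos_of_child h2 1
    have q1 := hA i 0 1 h01
    have q2 := hA i 0 2 h02
    have q3 := hA i 1 2 h12
    have := hexagon_le (h := A.m i - 2) (x := A.M i 0 1 - 1) (x' := A.M i 0 2 - 1)
      (y := A.M i 1 0 - 1) (y' := A.M i 1 2 - 1) (z := A.M i 2 0 - 1) (z' := A.M i 2 1 - 1)
      (by linarith) (by linarith) (by linarith) (by linarith) (by linarith) (by linarith)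
      (by linarith) (by linarith) (by linarith)
    nlinarith
  · exact key2 h01 h02 h12 h0 h1 h2
  · exact key2 h02 h01 h12.symm h0 h2 h1
  · exact key1 h01 h02 h12 h0 h1 h2
  · exact key2 h12 h01.symm h02.symm h1 h2 h0
  · exact key1 h01.symm h12 h02 h1 h0 h2
  · exact key1 h02.symm h12.symm h01 h2 h0 h1
  · have h := hge h01 h02 h12
    rw [uncut_of_no_child h0, uncut_of_no_child h1, uncut_of_no_child h2] at h
    nlinarith [mul_nonneg (show 0 ≤ A.m i - 1 by linarith) (show 0 ≤ A.m i - 1 by linarith)]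

theorem Idealistic.exists_D_lt_of_chi_neg (hA : A.Idealistic) {i : Fin r} (h : A.chi i < 0) :
    ∃ a b c : Fin 3, a ≠ b ∧ a ≠ c ∧ b ≠ c ∧ A.entry i a = none ∧ A.D i < A.rab i b c ∧
      (2 ≤ A.m i ∨ A.entry i b ≠ none ∧ A.entry i c ≠ none) := by
  by_contra! hcon
  have hone : ∀ {a b c : Fin 3} {l l' : Fin r}, a ≠ b → a ≠ c → b ≠ c → A.entry i a = none →
      A.entry i b = some l → A.entry i c = some l' → 0 ≤ A.chi i := by
    intro a b c l l' hab hac hbc ha hb hc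
    by_contra hneg
    rw [chi_eq hab hac hbc, free_of_none ha, free_of_entry hb, free_of_entry hc] at hneg
    have := (hcon a b c hab hac hbc ha (by linarith)).2 (by simp [hb])
    simp [hc] at this
  have htwo : ∀ {a b c : Fin 3} {l : Fin r}, a ≠ b → a ≠ c → b ≠ c → A.entry i a = none →
      A.entry i b = none → A.entry i c = some l → 0 ≤ A.chi i := by
    have hlt : ∀ {a b c : Fin 3} {l : Fin r}, a ≠ b → a ≠ c → b ≠ c → A.entry i a = none →
        A.entry i b = none → A.entry i c = some l → A.rab i b c ≤ A.D i := by
      intro a b c l hab hac hbc ha hb hc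
      by_contra! hD
      obtain ⟨⟨hb', hc'⟩, t, ht, hmt, -⟩ := hA.exists_child_of_D_lt hab hac hbc hD
      have h1 := (hcon a b c hab hac hbc ha hD).1
      have h2 := hA i a c hac
      have h3 := hA.D_nonneg i
      have h4 := M_of_child ht c
      have h5 := A.M_nonneg t c c
      rw [chi_eq hab hac hbc, free_of_none ha, free_of_none hb, free_of_entry hc,
        uncut_of_no_child hc'] at h
      simp only [rab, M_of_no_child hb', M_of_no_child hc'] at h h2
      linarith
    intro a b c l hab hac hbc ha hb hc
    exact hA.chi_nonneg_of_two_free hab hac hbc ha hb hc (hlt hab hac hbc ha hb hc)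
      (hlt hab.symm hbc hac hb ha hc)
  have h01 : (0 : Fin 3) ≠ 1 := by decide
  have h02 : (0 : Fin 3) ≠ 2 := by decide
  have h12 : (1 : Fin 3) ≠ 2 := by decide
  refine h.not_ge ?_
  rcases e0 : A.entry i 0 with _ | l0 <;> rcases e1 : A.entry i 1 with _ | l1 <;>
    rcases e2 : A.entry i 2 with _ | l2
  · have hfree : ∀ x, A.entry i x = none := by
      intro x
      fin_cases x <;> assumption
    refine hA.chi_nonneg_of_free hfree fun a b c hab hac hbc hm => ?_
    by_contra! hD
    exact hm.not_gt (hcon a b c hab hac hbc (hfree a) hD).1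
  · exact htwo h01 h02 h12 e0 e1 e2
  · exact htwo h02 h01 h12.symm e0 e2 e1
  · exact hone h01 h02 h12 e0 e1 e2
  · exact htwo h12 h01.symm h02.symm e1 e2 e0
  · exact hone h01.symm h12 h02 e1 e0 e2
  · exact hone h02.symm h12.symm h01 e2 e0 e1
  · rw [chi_eq h01 h02 h12, free_of_entry e0, free_of_entry e1, free_of_entry e2]
    linarith [hA.D_nonneg i]

/-- A node with negative `χ` is dominated by a node of larger multiplicity with positive `χ`. -/
theorem Idealistic.exists_chi_pos_of_chi_neg (hA : A.Idealistic) {i : Fin r} (h : A.chi i < 0) :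
    ∃ j, A.N i ∣ A.N j ∧ A.N i < A.N j ∧ 0 < A.chi j := by
  obtain ⟨a, b, c, hab, hac, hbc, ha, hD, hm⟩ := hA.exists_D_lt_of_chi_neg h
  obtain ⟨-, t, ht, hmt, htb, htc⟩ := hA.exists_child_of_D_lt hab hac hbc hD
  rw [← hmt, ← ht.entry_of_ne hab.symm, ← ht.entry_of_ne hac.symm] at hm
  obtain ⟨j, n, hj, hN⟩ := hA.exists_chi_pos hbc hab.symm hac.symm ht.entry_self htb htc hm
  have h1 := N_eq_of_ne (A := A) hab hac hbc t
  have h2 := N_eq_of_ne (A := A) hab hac hbc i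
  rw [entryN_child_self ht, entryN_child_of_ne ht hab.symm, entryN_child_of_ne ht hac.symm,
    hmt] at h1
  rw [entryN_of_none ha] at h2
  have hNj : A.N j = A.N i * (2 + n) := by
    rw [hN]
    linear_combination (1 + n : ℤ) * h1 - (1 + n : ℤ) * h2
  have hpos := A.N_pos i
  refine ⟨j, ⟨_, hNj⟩, ?_, hj⟩
  rw [hNj]
  nlinarith [Int.natCast_nonneg n]

/-- If some node with `d ∣ N` has positive `χ`, then the conclusion of the theorem holds. -/
theorem Idealistic.exists_sum_chi_pos (hA : A.Idealistic) {d : ℤ}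
    (h : ∃ i, d ∣ A.N i ∧ 0 < A.chi i) :
    ∃ k, d ∣ A.N k ∧ 0 < ∑ i ∈ Finset.univ.filter (fun i => A.N k ∣ A.N i), A.chi i := by
  obtain ⟨i, hi⟩ := h
  obtain ⟨k, hk, hmax⟩ := Finset.exists_max_image
    (Finset.univ.filter fun i => d ∣ A.N i ∧ 0 < A.chi i) A.N ⟨i, by simpa using hi⟩
  simp only [Finset.mem_filter, Finset.mem_univ, true_and] at hk hmax
  refine ⟨k, hk.1, Finset.sum_pos' (fun j hj => ?_) ⟨k, by simp, hk.2⟩⟩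
  have hkj := (Finset.mem_filter.1 hj).2
  by_contra! hneg
  obtain ⟨l, hdvd, hlt, hl⟩ := hA.exists_chi_pos_of_chi_neg hneg
  exact (hmax l ⟨hk.1.trans (hkj.trans hdvd), hl⟩).not_gt
    ((Int.le_of_dvd (A.N_pos j) hkj).trans_lt hlt)

/-! ### Euler characteristics of intersections -/

theorem card_Apair {a b c : Fin 3} (hab : a ≠ b) (hac : a ≠ c) (hbc : b ≠ c) {i j : Fin r}
    (h : A.entry j c = some i) :
    ((A.Apair i j).card : ℤ) = (1 - A.uncut j a) + (1 - A.uncut j b) := by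
  classical
  have hset : A.Apair i j = Finset.univ.filter (fun k => A.IsChild k j ∧ A.label k ≠ c) := by
    refine Finset.filter_congr fun k _ => and_congr_right fun hk => ?_
    have hk' : A.IsChildAt j (A.label k) k := ⟨hk.1, hk.2, rfl⟩
    rw [prox_iff]
    constructor
    · rintro ⟨z, hz⟩ hc
      rw [hc] at hk'
      rcases eq_or_ne z c with rfl | hzc
      · rw [hk'.entry_self] at hz
        exact (lt_of_entry h).ne (Option.some.inj hz).symm
      · rw [hk'.entry_of_ne hzc] at hz
        exact hzc (entry_label_unique hz h)
    · exact fun hc => ⟨c, by rw [hk'.entry_of_ne hc.symm, h]⟩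
  have hcard := congrArg (Nat.cast : ℕ → ℤ) (A.card_children j fun x => x ≠ c)
  rw [Nat.cast_sum, sum_fin_three hab hac hbc] at hcard
  push_cast at hcard
  rw [hset]
  refine Eq.trans (by congr!) (hcard.trans ?_)
  simp only [uncut]
  split_ifs <;> simp_all

theorem card_Bpair {a b c : Fin 3} (hab : a ≠ b) (hac : a ≠ c) (hbc : b ≠ c) {i j : Fin r}
    (h : A.entry j c = some i) :
    ((A.Bpair i j).card : ℤ) = 2 - A.free j a - A.free j b := by
  have hset : A.Bpair i j = (A.Bset j).erase i := by
    ext k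
    simp [Bpair, Bset]
  have hmem : i ∈ A.Bset j := by
    simpa [Bset] using A.prox_iff.2 ⟨c, h⟩
  have hcard := Finset.card_erase_add_one hmem
  have := card_Bset (A := A) hab hac hbc j
  rw [free_of_entry h] at this
  rw [hset]
  zify at hcard
  linarith

theorem card_Cpair {a b c : Fin 3} (hab : a ≠ b) (hac : a ≠ c) (hbc : b ≠ c) {i j : Fin r}
    (h : A.entry j c = some i) :
    ((A.Cpair i j).card : ℤ) =
      (1 - A.uncut j a) * (1 - A.free j b) + (1 - A.uncut j b) * (1 - A.free j a) := by
  classical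
  have hset : A.Cpair i j = Finset.univ.filter (fun k => A.IsChild k j ∧
      (A.label k ≠ c ∧ ∃ y, y ≠ c ∧ y ≠ A.label k ∧ A.entry j y ≠ none)) := by
    refine Finset.filter_congr fun k _ => and_congr_right fun hk => ?_
    have hk' : A.IsChildAt j (A.label k) k := ⟨hk.1, hk.2, rfl⟩
    simp only [prox_iff]
    constructor
    · rintro ⟨⟨z, hz⟩, l, hli, ⟨y, hy⟩, y', hy'⟩
      have hne : ∀ {x x' l'}, A.entry k x = some l' → A.entry j x' = some l' →
          x ≠ A.label k ∧ A.entry j x = some l' := by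
        intro x x' l' hx hx'
        have hxk : x ≠ A.label k := by
          rintro rfl
          rw [hk'.entry_self] at hx
          exact (lt_of_entry hx').ne (Option.some.inj hx).symm
        exact ⟨hxk, by rw [← hk'.entry_of_ne hxk, hx]⟩
      obtain ⟨hz1, hz2⟩ := hne hz h
      obtain ⟨hy1, hy2⟩ := hne hy hy'
      obtain rfl := entry_label_unique hz2 h
      refine ⟨hz1.symm, y, ?_, hy1, by simp [hy2]⟩
      rintro rfl
      exact hli (Option.some.inj (hy2.symm.trans h))
    · rintro ⟨hkc, y, hyc, hyk, hy⟩
      obtain ⟨l, hl⟩ := Option.ne_none_iff_exists'.1 hy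
      refine ⟨⟨c, by rw [hk'.entry_of_ne hkc.symm, h]⟩, l, ?_, ⟨y, by
        rw [hk'.entry_of_ne hyk, hl]⟩, y, hl⟩
      rintro rfl
      exact hyc (entry_label_unique hl h)
  have hexists : ∀ {a b : Fin 3}, a ≠ b → a ≠ c → b ≠ c →
      ((∃ y, y ≠ c ∧ y ≠ a ∧ A.entry j y ≠ none) ↔ A.entry j b ≠ none) := by
    intro a b hab hac hbc
    constructor
    · rintro ⟨y, hyc, hya, hy⟩
      rwa [eq_of_ne_of_ne hab hac hbc hya hyc] at hy
    · exact fun hb => ⟨b, hbc, hab.symm, hb⟩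
  have hterm : ∀ {x y : Fin 3}, x ≠ c →
      (if (∃ t, A.IsChildAt j x t) ∧ x ≠ c ∧ A.entry j y ≠ none then (1 : ℤ) else 0) =
        (1 - A.uncut j x) * (1 - A.free j y) := by
    intro x y hx
    simp only [uncut, free]
    split_ifs <;> simp_all
  have hcard := congrArg (Nat.cast : ℕ → ℤ) (A.card_children j fun x =>
    x ≠ c ∧ ∃ y, y ≠ c ∧ y ≠ x ∧ A.entry j y ≠ none)
  rw [Nat.cast_sum, sum_fin_three hab hac hbc] at hcard
  push_cast at hcard
  rw [hset]
  refine Eq.trans (by congr!) (hcard.trans ?_)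
  simp only [hexists hab hac hbc, hexists hab.symm hbc hac]
  rw [hterm hac, hterm hbc]
  simp

theorem chipair_eq {a b c : Fin 3} (hab : a ≠ b) (hac : a ≠ c) (hbc : b ≠ c) {i j : Fin r}
    (h : A.entry j c = some i) :
    A.chipair i j = -A.rab j a b + A.uncut j a * A.free j b + A.uncut j b * A.free j a := by
  rw [chipair, chi0pair_eq hab hac hbc h, card_Apair hab hac hbc h, card_Bpair hab hac hbc h,
    card_Cpair hab hac hbc h]
  ring

theorem chitriple_eq {a b c : Fin 3} (hab : a ≠ b) (hac : a ≠ c) (hbc : b ≠ c) {i j k : Fin r}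
    (hi : A.entry k b = some i) (hj : A.entry k c = some j) :
    A.chitriple i j k = A.uncut k a := by
  have hset : ∀ l, A.Prox l i ∧ A.Prox l j ∧ A.Prox l k ↔ A.IsChildAt k a l := by
    intro l
    simp only [prox_iff]
    constructor
    · rintro ⟨⟨x, hx⟩, ⟨y, hy⟩, z, hz⟩
      have hreach := entry_eq_some_iff.1 hz
      obtain ⟨h1, h2, hreach⟩ := hreach.of_entry hx (lt_of_entry hi)
      obtain rfl := entry_label_unique h1 hi
      obtain ⟨h3, h4, hreach⟩ := hreach.of_entry hy (lt_of_entry hj)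
      obtain rfl := entry_label_unique h3 hj
      obtain rfl := eq_of_ne_of_ne hab.symm hbc hac h2.symm h4.symm
      cases hreach with
      | base h => exact h
      | step _ _ h =>
        exact absurd (eq_of_ne_of_ne hab hac hbc h.1.1 h.2.symm) h.1.2.symm
    · intro h
      exact ⟨⟨b, by rw [h.entry_of_ne hab.symm, hi]⟩, ⟨c, by rw [h.entry_of_ne hac.symm, hj]⟩,
        a, h.entry_self⟩
  classical
  rw [chitriple, Finset.filter_congr fun l _ => hset l]
  by_cases ha : ∃ t, A.IsChildAt k a t
  · rw [uncut_of_child ha]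
    obtain ⟨t, ht⟩ := ha
    have : Finset.univ.filter (A.IsChildAt k a) = {t} := by
      ext l
      simpa using ⟨fun hl => hl.unique ht, fun hl => hl ▸ ht⟩
    rw [this]
    simp
  · rw [uncut_of_no_child ha, Finset.filter_false_of_mem fun l _ hl => ha ⟨l, hl⟩]
    simp

/-! ### Vanishing of the Euler characteristics of intersections -/

variable {d : ℤ}

theorem Idealistic.false_of_no_child (hA : A.Idealistic) (hχ : ∀ i, d ∣ A.N i → A.chi i = 0)
    {a b c : Fin 3} (hab : a ≠ b) (hac : a ≠ c) (hbc : b ≠ c) {k l : Fin r}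
    (hl : A.entry k c = some l) (hdk : d ∣ A.N k) (hdl : d ∣ A.N l)
    (ha : ¬ ∃ t, A.IsChildAt k a t) (hb : ¬ ∃ t, A.IsChildAt k b t)
    (hm : 2 ≤ A.m k ∨ A.entry k a ≠ none ∧ A.entry k b ≠ none) : False := by
  obtain ⟨j, n, hj, hN⟩ := hA.exists_chi_pos hab hac hbc hl ha hb hm
  exact hj.ne' (hχ j (hN ▸ dvd_add hdk (Dvd.dvd.mul_left (dvd_sub hdk hdl) _)))

theorem Idealistic.rab_eq_zero (hA : A.Idealistic) (hχ : ∀ i, d ∣ A.N i → A.chi i = 0)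
    {a b c : Fin 3} (hab : a ≠ b) (hac : a ≠ c) (hbc : b ≠ c) {k l : Fin r}
    (ha : A.entry k a ≠ none) (hb : A.entry k b ≠ none) (hl : A.entry k c = some l)
    (hdk : d ∣ A.N k) (hdl : d ∣ A.N l) : A.rab k a b = 0 := by
  have h := hχ k hdk
  obtain ⟨la, hla⟩ := Option.ne_none_iff_exists'.1 ha
  obtain ⟨lb, hlb⟩ := Option.ne_none_iff_exists'.1 hb
  rw [chi_eq hab hac hbc, free_of_entry hla, free_of_entry hlb, free_of_entry hl] at h
  by_contra hne
  have hpos := (hA.rab_nonneg k hab).lt_of_ne' hne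
  obtain ⟨⟨ha', hb'⟩, -⟩ := hA.exists_child_of_D_lt hac.symm hbc.symm hab
    (show A.D k < A.rab k a b by linarith)
  exact hA.false_of_no_child hχ hab hac hbc hl hdk hdl ha' hb' (Or.inr ⟨ha, hb⟩)

theorem D_eq_rab_of_chi {a b c : Fin 3} (hab : a ≠ b) (hac : a ≠ c) (hbc : b ≠ c)
    {k lb lc : Fin r} (hχ : A.chi k = 0) (ha : A.entry k a = none) (hb : A.entry k b = some lb)
    (hc : A.entry k c = some lc) : A.D k = A.rab k b c := by
  rw [chi_eq hab hac hbc, free_of_none ha, free_of_entry hb, free_of_entry hc] at hχ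
  linarith

theorem Idealistic.rab_le_one (hA : A.Idealistic) (hχ : ∀ i, d ∣ A.N i → A.chi i = 0)
    {a b c : Fin 3} (hab : a ≠ b) (hac : a ≠ c) (hbc : b ≠ c) {k lb lc : Fin r}
    (ha : A.entry k a = none) (hb : A.entry k b = some lb) (hc : A.entry k c = some lc)
    (hdk : d ∣ A.N k) (hdc : d ∣ A.N lc) : A.rab k a b ≤ 1 := by
  have hD := D_eq_rab_of_chi hab hac hbc (hχ k hdk) ha hb hc
  have hβ := A.M_nonneg k b a
  have hα := A.M_nonneg k a b
  by_contra! hlt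
  rcases (hA.D_nonneg k).eq_or_lt with h0 | h0
  · obtain ⟨⟨ha', hb'⟩, -⟩ := hA.exists_child_of_D_lt hac.symm hbc.symm hab
      (show A.D k < A.rab k a b by linarith)
    refine hA.false_of_no_child hχ hab hac hbc hc hdk hdc ha' hb' (Or.inl ?_)
    rw [rab] at hlt
    linarith
  · have hH := hA.mul_rab_le_D hab hac hbc k
    rw [← hD] at hH
    rw [rab] at hlt
    nlinarith

/-- If every node with `d ∣ N` has `χ = 0`, then a chain along `x` starting at `t` whose total
contribution to `N` is divisible by `d` cannot occur above a node with two further cone entries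
divisible by `d`. -/
theorem Idealistic.false_of_chain (hA : A.Idealistic) (hχ : ∀ i, d ∣ A.N i → A.chi i = 0)
    {x y z : Fin 3} (hxy : x ≠ y) (hxz : x ≠ z) (hyz : y ≠ z) {t l : Fin r}
    (hz : A.entry t z = some l) (hdz : d ∣ A.N l) (hy : A.entry t y ≠ none)
    (hdy : d ∣ A.entryN t y) (hx : A.entry t x ≠ none ∨ ∃ u, A.IsChildAt t x u)
    (hdx : d ∣ A.entryN t x + (A.m t + A.M t x x)) : False := by
  induction t using WellFoundedGT.induction with
  | ind t ih =>
    have hN := N_eq_of_ne (A := A) hxy hxz hyz t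
    rw [entryN_of_entry hz] at hN
    by_cases hu : ∃ u, A.IsChildAt t x u
    · obtain ⟨u, hu⟩ := hu
      refine ih u hu.lt (by rw [hu.entry_of_ne hxz.symm, hz]) (by rwa [hu.entry_of_ne hxy.symm])
        (by rwa [entryN_child_of_ne hu hxy.symm]) (Or.inl (by simp [hu.entry_self])) ?_
      rw [entryN_child_self hu, ← M_of_child hu]
      have : A.N t + A.M t x x =
          A.entryN t x + (A.m t + A.M t x x) + A.entryN t y + A.N l := by
        linarith
      exact this ▸ dvd_add (dvd_add hdx hdy) hdz
    · rw [M_of_no_child hu, add_zero] at hdx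
      have hdt : d ∣ A.N t := by
        rw [hN, add_comm (A.m t)]
        exact dvd_add (dvd_add hdx hdy) hdz
      have hrab := hA.rab_eq_zero hχ hxy hxz hyz (hx.resolve_right hu) hy hz hdt hdz
      rw [rab, M_of_no_child hu, sub_zero] at hrab
      obtain ⟨w, hw⟩ : ∃ w, A.IsChildAt t y w := by
        by_contra hno
        rw [M_of_no_child hno, sub_zero] at hrab
        exact (A.m_pos t).ne' hrab
      refine ih w hw.lt (by rw [hw.entry_of_ne hyz.symm, hz]) (by simp [hw.entry_self])
        (by rwa [entryN_child_self hw]) (Or.inl ?_) ?_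
      · rw [hw.entry_of_ne hxy]
        exact hx.resolve_right hu
      · rwa [entryN_child_of_ne hw hxy, ← M_of_child hw, ← sub_eq_zero.1 hrab]

theorem Idealistic.chitriple_eq_zero (hA : A.Idealistic) (hd : 2 ≤ d)
    (hχ : ∀ i, d ∣ A.N i → A.chi i = 0) {a b c : Fin 3} (hab : a ≠ b) (hac : a ≠ c)
    (hbc : b ≠ c) {i j k : Fin r} (hi : A.entry k b = some i) (hj : A.entry k c = some j)
    (hdi : d ∣ A.N i) (hdj : d ∣ A.N j) (hdk : d ∣ A.N k) : A.chitriple i j k = 0 := by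
  rw [chitriple_eq hab hac hbc hi hj]
  by_contra hne
  have ha : ¬ ∃ t, A.IsChildAt k a t := fun h => hne (uncut_of_child h)
  have hm := A.m_pos k
  have hN := N_eq_of_ne (A := A) hab hac hbc k
  rw [entryN_of_entry hi, entryN_of_entry hj] at hN
  have hdm : d ∣ A.entryN k a + A.m k := by
    have : A.entryN k a + A.m k = A.N k - A.N i - A.N j := by linarith
    exact this ▸ dvd_sub (dvd_sub hdk hdi) hdj
  have chain : ∀ {b c : Fin 3} {i j : Fin r}, a ≠ b → a ≠ c → b ≠ c → A.entry k b = some i →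
      A.entry k c = some j → d ∣ A.N j → A.rab k a b = 0 →
      ∃ t, A.IsChildAt k b t ∧ A.M k b a = A.m k ∧
        ¬ (A.entry t a ≠ none ∨ ∃ u, A.IsChildAt t a u) := by
    intro b c i j hab hac hbc hi hj hdj h0
    rw [rab, M_of_no_child ha, sub_zero] at h0
    obtain ⟨t, ht⟩ : ∃ t, A.IsChildAt k b t := by
      by_contra hno
      rw [M_of_no_child hno, sub_zero] at h0
      exact hm.ne' h0
    refine ⟨t, ht, by linarith, fun hx => ?_⟩
    refine hA.false_of_chain hχ hac hab hbc.symm ht.entry_self hdk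
      (by simp [ht.entry_of_ne hbc.symm, hj])
      (by rwa [entryN_child_of_ne ht hbc.symm, entryN_of_entry hj]) hx ?_
    rwa [entryN_child_of_ne ht hab, ← M_of_child ht, ← sub_eq_zero.1 h0]
  by_cases hea : A.entry k a = none
  · rw [entryN_of_none hea, zero_add] at hdm
    have hm2 : 2 ≤ A.m k := hd.trans (Int.le_of_dvd hm hdm)
    have hD := D_eq_rab_of_chi hab hac hbc (hχ k hdk) hea hi hj
    have hH := hA.mul_rab_le_D hab hac hbc k
    have hra := hA.rab_nonneg k hbc
    rw [M_of_no_child ha, sub_zero, hD] at hH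
    have hD0 : A.D k = 0 := by nlinarith
    have hzero : ∀ {b c : Fin 3} {j : Fin r}, a ≠ b → a ≠ c → b ≠ c →
        A.entry k c = some j → d ∣ A.N j → A.rab k a b = 0 := by
      intro b c j hab hac hbc hj hdj
      by_contra hne
      have hpos := (hA.rab_nonneg k hab).lt_of_ne' hne
      obtain ⟨⟨ha', hb'⟩, -⟩ := hA.exists_child_of_D_lt hac.symm hbc.symm hab
        (show A.D k < A.rab k a b by linarith)
      exact hA.false_of_no_child hχ hab hac hbc hj hdk hdj ha' hb' (Or.inl hm2)
    have hlarge : ∀ {b c : Fin 3} {i j : Fin r}, a ≠ b → a ≠ c → b ≠ c →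
        A.entry k b = some i → A.entry k c = some j → d ∣ A.N j → A.m k ≤ A.M k b c := by
      intro b c i j hab hac hbc hi hj hdj
      obtain ⟨t, ht, hM, hno⟩ := chain hab hac hbc hi hj hdj (hzero hab hac hbc hj hdj)
      rw [M_of_child ht, M_of_no_child fun h => hno (Or.inr h)] at hM
      rw [M_of_child ht]
      linarith [A.M_nonneg t c c]
    have h1 := hlarge hab hac hbc hi hj hdj
    have h2 := hlarge hac hab hbc.symm hj hi hdi
    linarith [hA k b c hbc]
  · obtain ⟨t, ht, -, hno⟩ := chain hab hac hbc hi hj hdj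
      (hA.rab_eq_zero hχ hab hac hbc hea (by simp [hi]) hj hdk hdj)
    exact hno (Or.inl (by rwa [ht.entry_of_ne hab]))

theorem Idealistic.rab_eq_uncut (hA : A.Idealistic) (hχ : ∀ i, d ∣ A.N i → A.chi i = 0)
    {a b c : Fin 3} (hab : a ≠ b) (hac : a ≠ c) (hbc : b ≠ c) {i k l : Fin r}
    (ha : A.entry k a = none) (hb : A.entry k b = some l) (hc : A.entry k c = some i)
    (hdi : d ∣ A.N i) (hdk : d ∣ A.N k) : A.rab k a b = A.uncut k b := by
  have hle := hA.rab_le_one hχ hab hac hbc ha hb hc hdk hdi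
  have hge := hA.rab_nonneg k hab
  by_cases hbb : ∃ t, A.IsChildAt k b t
  · rw [uncut_of_child hbb]
    by_contra hne
    have hpos := hge.lt_of_ne' hne
    have hD := D_eq_rab_of_chi hab hac hbc (hχ k hdk) ha hb hc
    rcases lt_or_ge (A.D k) (A.rab k a b) with h | h
    · exact (hA.exists_child_of_D_lt hac.symm hbc.symm hab h).1.2 hbb
    · have hH := hA.mul_rab_le_D hab hac hbc k
      have hβ := M_pos_of_child hbb a
      have hD0 := hpos.trans_le h
      rw [← hD] at hH
      rw [rab] at hpos
      nlinarith
  · rw [uncut_of_no_child hbb]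
    by_contra hne
    have h0 : A.rab k a b = 0 := by omega
    rw [rab, M_of_no_child hbb, sub_zero] at h0
    obtain ⟨t, ht⟩ : ∃ t, A.IsChildAt k a t := by
      by_contra hno
      rw [M_of_no_child hno, sub_zero] at h0
      exact (A.m_pos k).ne' h0
    have hN := N_eq_of_ne (A := A) hab hac hbc k
    rw [entryN_of_none ha, entryN_of_entry hc, add_zero] at hN
    refine hA.false_of_chain hχ hbc hab.symm hac.symm ht.entry_self hdk
      (by simp [ht.entry_of_ne hac.symm, hc])
      (by rwa [entryN_child_of_ne ht hac.symm, entryN_of_entry hc])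
      (Or.inl (by simp [ht.entry_of_ne hab.symm, hb])) ?_
    rw [entryN_child_of_ne ht hab.symm, ← M_of_child ht, ← sub_eq_zero.1 h0]
    have : A.entryN k b + A.m k = A.N k - A.N i := by linarith
    exact this ▸ dvd_sub hdk hdi

theorem D_le_of_child {i t : Fin r} {x : Fin 3} (ht : A.IsChildAt i x t) :
    A.D i ≤ A.m i ^ 2 - A.m t ^ 2 := by
  have hmem : t ∈ A.proxSet i := by
    simpa [proxSet] using A.prox_iff.2 ⟨x, ht.entry_self⟩
  have := Finset.single_le_sum (f := fun j => A.m j ^ 2) (fun j _ => sq_nonneg _) hmem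
  rw [D]
  linarith

/-- The lower bound for `χ` at a node with one cone entry `c`. -/
theorem Idealistic.chi_ge_of_two_free (hA : A.Idealistic) {a b c : Fin 3} (hab : a ≠ b)
    (hac : a ≠ c) (hbc : b ≠ c) {i l : Fin r} (ha : A.entry i a = none)
    (hb : A.entry i b = none) (hc : A.entry i c = some l) :
    (A.m i - 1) ^ 2 - (A.M i a b - 1) * A.M i a c - (A.M i b a - 1) * A.M i b c
      - (1 - A.uncut i c) * ((A.M i c a - 1) * (A.M i c b - 1)) ≤ A.chi i := by
  have hD := hA.D_ge hab hac hbc i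
  rw [chi_eq hab hac hbc, free_of_none ha, free_of_none hb, free_of_entry hc]
  simp only [rab]
  by_cases hcc : ∃ t, A.IsChildAt i c t
  · rw [uncut_of_child hcc]
    linarith
  · rw [uncut_of_no_child hcc]
    rw [M_of_no_child hcc, M_of_no_child hcc] at hD ⊢
    linarith

theorem Idealistic.false_of_two_free_of_no_child (hA : A.Idealistic)
    (hχ : ∀ i, d ∣ A.N i → A.chi i = 0) {a b c : Fin 3} (hab : a ≠ b) (hac : a ≠ c)
    (hbc : b ≠ c) {k l : Fin r} (ha : A.entry k a = none) (hb : A.entry k b = none)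
    (hc : A.entry k c = some l) (hdl : d ∣ A.N l) (hdk : d ∣ A.N k) (hm : 2 ≤ A.m k)
    (hbb : ¬ ∃ t, A.IsChildAt k b t) : False := by
  have hge := hA.chi_ge_of_two_free hab hac hbc ha hb hc
  rw [hχ k hdk, M_of_no_child hbb, M_of_no_child hbb, mul_zero, sub_zero] at hge
  have h1 := hA k a b hab
  have h2 := hA k a c hac
  have h3 := hA k b c hbc
  rw [M_of_no_child hbb] at h1 h3
  rw [add_zero] at h1
  rw [zero_add] at h3
  have hγ := A.M_nonneg k c a
  by_cases haa : ∃ t, A.IsChildAt k a t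
  · have hα' := M_pos_of_child haa c
    rcases h1.eq_or_lt with h4 | h4
    · obtain ⟨t, ht⟩ := haa
      have hdm : d ∣ A.m k := by
        have hN := N_eq_of_ne (A := A) hab hac hbc k
        rw [entryN_of_none ha, entryN_of_none hb, entryN_of_entry hc] at hN
        have : A.m k = A.N k - A.N l := by linarith
        exact this ▸ dvd_sub hdk hdl
      by_cases hu : ∃ u, A.IsChildAt t b u
      · refine hA.false_of_chain hχ hbc hab.symm hac.symm ht.entry_self hdk
          (by simp [ht.entry_of_ne hac.symm, hc])
          (by rwa [entryN_child_of_ne ht hac.symm, entryN_of_entry hc]) (Or.inr hu) ?_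
        rwa [entryN_child_of_ne ht hab.symm, entryN_of_none hb, zero_add, ← M_of_child ht, h4]
      · rw [M_of_child ht, M_of_no_child hu, add_zero] at h4
        have hD := D_le_of_child ht
        have hM := M_of_child ht c
        have := A.M_nonneg t c c
        have hcc : ¬ ∃ t, A.IsChildAt k c t := no_child_of_M_nonpos (b := a) (by linarith)
        have hzero := hχ k hdk
        rw [chi_eq hab hac hbc, free_of_none ha, free_of_none hb, free_of_entry hc,
          uncut_of_no_child hcc] at hzero
        simp only [rab, M_of_no_child hbb, M_of_no_child hcc] at hzero
        rw [h4] at hD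
        linarith
    · by_cases hcc : ∃ t, A.IsChildAt k c t
      · rw [uncut_of_child hcc] at hge
        have := M_pos_of_child hcc a
        have := M_pos_of_child hcc b
        nlinarith [mul_nonneg (show 0 ≤ A.M k c a - 1 by linarith)
          (show 0 ≤ A.m k - A.M k c b by linarith),
          mul_nonneg (show 0 ≤ A.m k - 1 - A.M k a b by linarith) hα'.le,
          mul_nonneg (show 0 ≤ A.m k - A.M k a c - A.M k c a by linarith)
          (show 0 ≤ A.m k - 1 by linarith)]
      · rw [uncut_of_no_child hcc] at hge
        nlinarith [mul_nonneg (show 0 ≤ A.m k - 1 - A.M k a b by linarith) hα'.le,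
          mul_nonneg (show 0 ≤ A.m k - A.M k a c by linarith) (show 0 ≤ A.m k - 2 by linarith)]
  · exact hA.false_of_no_child hχ hab hac hbc hc hdk hdl haa hbb (Or.inl hm)

theorem Idealistic.false_of_two_free (hA : A.Idealistic) (hd : 2 ≤ d)
    (hχ : ∀ i, d ∣ A.N i → A.chi i = 0) {a b c : Fin 3} (hab : a ≠ b) (hac : a ≠ c)
    (hbc : b ≠ c) {k l : Fin r} (ha : A.entry k a = none) (hb : A.entry k b = none)
    (hc : A.entry k c = some l) (hdl : d ∣ A.N l) (hdk : d ∣ A.N k) : False := by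
  have hm : 2 ≤ A.m k := by
    refine hd.trans (Int.le_of_dvd (A.m_pos k) ?_)
    have hN := N_eq_of_ne (A := A) hab hac hbc k
    rw [entryN_of_none ha, entryN_of_none hb, entryN_of_entry hc] at hN
    have : A.m k = A.N k - A.N l := by linarith
    exact this ▸ dvd_sub hdk hdl
  by_cases hbb : ∃ t, A.IsChildAt k b t
  · by_cases haa : ∃ t, A.IsChildAt k a t
    · have hge := hA.chi_ge_of_two_free hab hac hbc ha hb hc
      rw [hχ k hdk] at hge
      have p1 := M_pos_of_child haa b
      have p2 := M_pos_of_child haa c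
      have p3 := M_pos_of_child hbb a
      have p4 := M_pos_of_child hbb c
      have q1 := hA k a b hab
      have q2 := hA k a c hac
      have q3 := hA k b c hbc
      have p5 := A.M_nonneg k c a
      have p6 := A.M_nonneg k c b
      by_cases hcc : ∃ t, A.IsChildAt k c t
      · rw [uncut_of_child hcc] at hge
        have p5 := M_pos_of_child hcc a
        have p6 := M_pos_of_child hcc b
        have := hexagon_le (h := A.m k - 1) (x := A.M k a b - 1) (x' := A.M k a c)
          (y := A.M k b a) (y' := A.M k b c) (z := A.M k c a - 1) (z' := A.M k c b - 1)
          (by linarith) (by linarith) (by linarith) (by linarith) (by linarith) (by linarith)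
          (by linarith) (by linarith) (by linarith)
        linarith
      · rw [uncut_of_no_child hcc] at hge
        nlinarith [mul_nonneg (show 0 ≤ A.M k a b - 1 by linarith)
          (show 0 ≤ A.m k - A.M k a c by linarith),
          mul_nonneg (show 0 ≤ A.M k b a - 1 by linarith)
          (show 0 ≤ A.m k - A.M k b c by linarith)]
    · exact hA.false_of_two_free_of_no_child hχ hab.symm hbc hac hb ha hc hdl hdk hm haa
  · exact hA.false_of_two_free_of_no_child hχ hab hac hbc ha hb hc hdl hdk hm hbb

theorem Idealistic.chipair_eq_zero (hA : A.Idealistic) (hd : 2 ≤ d)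
    (hχ : ∀ i, d ∣ A.N i → A.chi i = 0) {a b c : Fin 3} (hab : a ≠ b) (hac : a ≠ c)
    (hbc : b ≠ c) {i k : Fin r} (hc : A.entry k c = some i) (hdi : d ∣ A.N i)
    (hdk : d ∣ A.N k) : A.chipair i k = 0 := by
  rw [chipair_eq hab hac hbc hc]
  rcases ha : A.entry k a with _ | la <;> rcases hb : A.entry k b with _ | lb
  · exact (hA.false_of_two_free hd hχ hab hac hbc ha hb hc hdi hdk).elim
  · rw [free_of_none ha, free_of_entry hb,
      hA.rab_eq_uncut hχ hab hac hbc ha hb hc hdi hdk]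
    ring
  · rw [free_of_entry ha, free_of_none hb, rab_comm,
      hA.rab_eq_uncut hχ hab.symm hbc hac hb ha hc hdi hdk]
    ring
  · rw [free_of_entry ha, free_of_entry hb,
      hA.rab_eq_zero hχ hab hac hbc (by simp [ha]) (by simp [hb]) hc hdk hdi]
    ring

theorem Idealistic.zetaR_eq_zero (hA : A.Idealistic) {d : ℕ} (hd : 2 ≤ d)
    (hχ : ∀ i, (d : ℤ) ∣ A.N i → A.chi i = 0) : A.ZetaR d = 0 := by
  have hd' : (2 : ℤ) ≤ d := mod_cast hd
  have other : ∀ c : Fin 3, ∃ a b, a ≠ b ∧ a ≠ c ∧ b ≠ c := by decide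
  have third : ∀ b c : Fin 3, b ≠ c → ∃ a, a ≠ b ∧ a ≠ c := by decide
  rw [ZetaR, Finset.sum_eq_zero, Finset.sum_eq_zero, Finset.sum_eq_zero, add_zero, add_zero]
  · rintro ⟨i, j, k⟩ h
    simp only [Finset.mem_filter, Finset.mem_univ, true_and] at h
    obtain ⟨hij, -, hki, hkj, hdi, hdj, hdk⟩ := h
    obtain ⟨b, hb⟩ := A.prox_iff.1 hki
    obtain ⟨c, hc⟩ := A.prox_iff.1 hkj
    have hbc : b ≠ c := by
      rintro rfl
      exact hij.ne (Option.some.inj (hb.symm.trans hc))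
    obtain ⟨a, hab, hac⟩ := third b c hbc
    rw [hA.chitriple_eq_zero hd' hχ hab hac hbc hb hc hdi hdj hdk, Int.cast_zero, zero_div]
  · rintro ⟨i, k⟩ h
    obtain ⟨hki, hdi, hdk⟩ := (Finset.mem_filter.1 h).2
    obtain ⟨c, hc⟩ := A.prox_iff.1 hki
    obtain ⟨a, b, hab, hac, hbc⟩ := other c
    rw [hA.chipair_eq_zero hd' hχ hab hac hbc hc hdi hdk, Int.cast_zero, zero_div]
  · intro i hi
    rw [hχ i (Finset.mem_filter.1 hi).2, Int.cast_zero, zero_div]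

end ToricCluster

theorem stmt17 {r : ℕ} (A : ToricCluster r) (hA : A.Idealistic)
    (d : ℕ) (hd : 2 ≤ d)
    (hpole : (A.ZetaR d).denom.natDegree ≠ 0) :
    ∃ k : Fin r, (d : ℤ) ∣ A.N k ∧
      0 < ∑ i ∈ Finset.univ.filter (fun i => A.N k ∣ A.N i), A.chi i := by
  refine hA.exists_sum_chi_pos ?_
  by_contra! hle
  refine hpole ?_
  rw [hA.zetaR_eq_zero hd fun i hi => ?_]
  · simp
  · by_contra hne
    obtain ⟨j, hdvd, -, hj⟩ := hA.exists_chi_pos_of_chi_neg ((hle i hi).lt_of_ne hne)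
    exact hj.not_ge (hle j (hi.trans hdvd))
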